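/- arXiv:1412.3960 — 2 statements merged into one kernel-verified Lean document; each statement's English description precedes it below -/
import Mathlib

section
/- Let A be a finite nonempty subset of ℤ^d (d ≥ 3). Then under P_{ē_A} (the continuous-time simple random walk started from the normalized equilibrium measure of A), the random variable ∫₀^∞ e_A(X_s) ds is distributed as an exponential random variable of parameter 1; that is, the law of ω ↦ ∫₀^∞ e_A(X_s(ω)) ds under P_{ē_A} equals the exponential distribution of rate 1 on [0,∞). -/
open MeasureTheory ENNReal Set
open scoped Classical NNReal

namespace Disconnection

/-- Points of `ℤ^d`. -/
abbrev Zd (d : ℕ) := Fin d → ℤ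

/-- Step distribution of the simple random walk: uniform weight `1/(2d)` on each of the
`2d` unit vectors of `ℤ^d`. -/
noncomputable def stepP (d : ℕ) (v : Zd d) : ℝ≥0∞ :=
  if (∑ i, (v i).natAbs) = 1 then ((2 * d : ℕ) : ℝ≥0∞)⁻¹ else 0

/-- The exponential distribution of rate `1` on `[0,∞)` (as a measure on `ℝ`). -/
noncomputable def expMeasure : Measure ℝ :=
  MeasureTheory.volume.withDensity fun t => ENNReal.ofReal (if 0 < t then Real.exp (-t) else 0)

/-- Nearest neighbours in `ℤ^d` (Euclidean distance one). -/
def adjacent {d : ℕ} (x y : Zd d) : Prop := (∑ i, (x i - y i).natAbs) = 1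

/-- (Outer) boundary `∂A` of a set `A ⊆ ℤ^d`. -/
def bdry {d : ℕ} (A : Set (Zd d)) : Set (Zd d) := {y | y ∉ A ∧ ∃ x ∈ A, adjacent x y}

/-- sup-norm distance between two points of `ℤ^d`. -/
def supDist {d : ℕ} (x y : Zd d) : ℕ := Finset.univ.sup fun i => (x i - y i).natAbs

/-- closed sup-norm ball `B(x,r)` in `ℤ^d`. -/
def ball {d : ℕ} (x : Zd d) (r : ℕ) : Set (Zd d) := {y | supDist x y ≤ r}

/-- mutual sup-norm distance between two sets. -/
noncomputable def setDist {d : ℕ} (A B : Set (Zd d)) : ℕ := sInf {n | ∃ x ∈ A, ∃ y ∈ B, supDist x y = n}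

/-- the box `ℤ^d ∩ [a,b)^d`. -/
def intBox {d : ℕ} (a b : ℤ) : Set (Zd d) := {y | ∀ i, a ≤ y i ∧ y i < b}

/-- A box in `ℤ^d`: a translate of `[0,L)^d ∩ ℤ^d` with `L ≥ 1`. -/
def isBox {d : ℕ} (S : Set (Zd d)) : Prop :=
  ∃ L : ℕ, 1 ≤ L ∧ ∃ a : Zd d, S = {y | ∀ i, a i ≤ y i ∧ y i < a i + L}

/-- connectedness of a subset of `ℤ^d` by nearest-neighbour paths. -/
def connSet {d : ℕ} (S : Set (Zd d)) : Prop :=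
  ∀ a ∈ S, ∀ b ∈ S, ∃ (n : ℕ) (f : ℕ → Zd d), f 0 = a ∧ f n = b ∧
    (∀ k ≤ n, f k ∈ S) ∧ ∀ k < n, adjacent (f k) (f (k + 1))

/-- Euclidean norm of a lattice point. -/
noncomputable def eucNorm {d : ℕ} (x : Zd d) : ℝ := Real.sqrt (∑ i, ((x i : ℝ)) ^ 2)

/-- A model of the continuous-time simple random walk on `ℤ^d` with unit jump rate:
`Y` is the discrete jump chain and `ζ` are the holding times; under `P x` one has
`Y 0 = x` a.s., and the increments of `Y` together with the holding times are mutually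
independent, the increments uniform on the `2d` unit vectors and the holding times
exponential of rate `1`.  This is expressed through the finite-dimensional cylinder
probabilities, which determine the joint law. -/
structure SRW (d : ℕ) (Ω : Type*) [MeasurableSpace Ω] where
  P : Zd d → Measure Ω
  isProb : ∀ x, IsProbabilityMeasure (P x)
  Y : ℕ → Ω → Zd d
  ζ : ℕ → Ω → ℝ
  measurable_Y : ∀ n, Measurable (Y n)
  measurable_ζ : ∀ n, Measurable (ζ n)
  Y_zero : ∀ x : Zd d, P x {ω | Y 0 ω = x} = 1
  law : ∀ (x : Zd d) (n : ℕ) (s : Fin n → Zd d) (I : Fin n → Set ℝ),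
    (∀ i, MeasurableSet (I i)) →
    P x {ω | (∀ i : Fin n, Y ((i : ℕ) + 1) ω - Y (i : ℕ) ω = s i) ∧
             (∀ i : Fin n, ζ (i : ℕ) ω ∈ I i)}
      = (∏ i, stepP d (s i)) * ∏ i, expMeasure (I i)

namespace SRW

variable {d : ℕ} {Ω : Type*} [MeasurableSpace Ω]

/-- time of the `n`-th jump. -/
noncomputable def S (W : SRW d Ω) (n : ℕ) (ω : Ω) : ℝ := ∑ i ∈ Finset.range n, W.ζ i ω

/-- index of the current step of the jump chain at time `t`. -/
noncomputable def jumpIdx (W : SRW d Ω) (t : ℝ) (ω : Ω) : ℕ := sSup {k : ℕ | W.S k ω ≤ t}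

/-- the continuous-time walk `X_t`. -/
noncomputable def X (W : SRW d Ω) (t : ℝ) (ω : Ω) : Zd d := W.Y (W.jumpIdx t ω) ω

/-- entrance time of `A` after time `t` (`∞` if there is none). -/
noncomputable def hitFrom (W : SRW d Ω) (A : Set (Zd d)) (t : ℝ≥0∞) (ω : Ω) : ℝ≥0∞ :=
  sInf {u : ℝ≥0∞ | ∃ s : ℝ≥0, u = (s : ℝ≥0∞) ∧ t ≤ u ∧ W.X (s : ℝ) ω ∈ A}

/-- entrance time `H_A = inf {t ≥ 0 : X_t ∈ A}`. -/
noncomputable def hit (W : SRW d Ω) (A : Set (Zd d)) (ω : Ω) : ℝ≥0∞ := W.hitFrom A 0 ω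

/-- exit time `T_U = inf {t ≥ 0 : X_t ∉ U}`. -/
noncomputable def exit (W : SRW d Ω) (U : Set (Zd d)) (ω : Ω) : ℝ≥0∞ := W.hit Uᶜ ω

/-- hitting time `H̃_A = inf {t ≥ ζ₀ : X_t ∈ A}`. -/
noncomputable def hitTilde (W : SRW d Ω) (A : Set (Zd d)) (ω : Ω) : ℝ≥0∞ :=
  W.hitFrom A (ENNReal.ofReal (W.ζ 0 ω)) ω

/-- the walk evaluated at a random (possibly infinite) time. -/
noncomputable def Xat (W : SRW d Ω) (τ : Ω → ℝ≥0∞) (ω : Ω) : Zd d := W.X (τ ω).toReal ω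

/-- equilibrium measure `e_A(x) = P_x[H̃_A = ∞] 1_A(x)`. -/
noncomputable def eqm (W : SRW d Ω) (A : Set (Zd d)) (x : Zd d) : ℝ :=
  if x ∈ A then (W.P x {ω | W.hitTilde A ω = ⊤}).toReal else 0

/-- capacity `cap(A) = Σ_x e_A(x)`. -/
noncomputable def cap (W : SRW d Ω) (A : Set (Zd d)) : ℝ := ∑ᶠ x, W.eqm A x

/-- normalized equilibrium measure `ē_A = e_A / cap(A)`. -/
noncomputable def ebar (W : SRW d Ω) (A : Set (Zd d)) (x : Zd d) : ℝ := W.eqm A x / W.cap A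

/-- equilibrium measure of `A` relative to `U`: `e_{A,U}(x) = P_x[H̃_A > T_U] 1_A(x)`. -/
noncomputable def eqmRel (W : SRW d Ω) (A U : Set (Zd d)) (x : Zd d) : ℝ :=
  if x ∈ A then (W.P x {ω | W.exit U ω < W.hitTilde A ω}).toReal else 0

/-- `P_ρ = Σ_x ρ(x) P_x`, the walk started from the initial (sub-)measure with density `ρ`. -/
noncomputable def Pinit (W : SRW d Ω) (ρ : Zd d → ℝ) : Measure Ω :=
  Measure.sum fun x : Zd d => ENNReal.ofReal (ρ x) • W.P x

/-- Green function `g(x,y) = E_x[∫₀^∞ 1{X_s = y} ds]`. -/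
noncomputable def green (W : SRW d Ω) (x y : Zd d) : ℝ :=
  ∫ ω, (∫ s in Set.Ioi (0 : ℝ), if W.X s ω = y then (1 : ℝ) else 0) ∂ W.P x

/-- killed Green function `g_U(x,y) = E_x[∫₀^{T_U} 1{X_s = y} ds]`. -/
noncomputable def greenK (W : SRW d Ω) (U : Set (Zd d)) (x y : Zd d) : ℝ :=
  ∫ ω, (∫ s in Set.Ioi (0 : ℝ),
      if ENNReal.ofReal s < W.exit U ω ∧ W.X s ω = y then (1 : ℝ) else 0) ∂ W.P x

/-- the potential operator `Gf(x) = Σ_y g(x,y) f(y)`. -/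
noncomputable def Gop (W : SRW d Ω) (f : Zd d → ℝ) (x : Zd d) : ℝ :=
  ∑ᶠ y, W.green x y * f y

/-- successive return times to `A` (between excursions out of `U`): `Rt A U 0 = R₁ = H_A`. -/
noncomputable def Rt (W : SRW d Ω) (A U : Set (Zd d)) : ℕ → Ω → ℝ≥0∞
  | 0 => W.hit A
  | k + 1 => fun ω => W.hitFrom A (W.hitFrom Uᶜ (W.Rt A U k ω) ω) ω

/-- successive departure times from `U`: `Dt A U k = D_{k+1}`. -/
noncomputable def Dt (W : SRW d Ω) (A U : Set (Zd d)) (k : ℕ) (ω : Ω) : ℝ≥0∞ :=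
  W.hitFrom Uᶜ (W.Rt A U k ω) ω

/-- number of excursions from `A` to the complement of `U`:
`N_{A,U} = sup {k ≥ 1 : D_k < ∞}` (with `sup ∅ = 0`). -/
noncomputable def Nexc (W : SRW d Ω) (A U : Set (Zd d)) (ω : Ω) : ℕ :=
  sSup {n | 0 < n ∧ W.Dt A U (n - 1) ω < ⊤}

end SRW

end Disconnection

namespace Disconnection
namespace Aux

/-- one-step operator -/
noncomputable def Pop {d : ℕ} (φ : Zd d → ℝ) (x : Zd d) : ℝ :=
  (∑ i, (φ (x + Pi.single i 1) + φ (x - Pi.single i 1))) / (2 * d)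

lemma Pop_mono {d : ℕ} {φ ψ : Zd d → ℝ} (h : ∀ x, φ x ≤ ψ x) (x : Zd d) : Pop φ x ≤ Pop ψ x := by
  unfold Pop
  gcongr <;> apply h

lemma Pop_nonneg {d : ℕ} {φ : Zd d → ℝ} (h : ∀ x, 0 ≤ φ x) (x : Zd d) : 0 ≤ Pop φ x := by
  unfold Pop
  have : ∀ i, 0 ≤ (φ (x + Pi.single i 1) + φ (x - Pi.single i 1)) := fun i => add_nonneg (h _) (h _)
  have := Finset.sum_nonneg (s := Finset.univ) (fun i _ => this i)
  positivity

lemma Pop_smul {d : ℕ} (φ : Zd d → ℝ) (c : ℝ) (x : Zd d) :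
    Pop (fun y => c * φ y) x = c * Pop φ x := by
  unfold Pop
  simp_rw [← mul_add, ← Finset.mul_sum, mul_div_assoc]

lemma Pop_const {d : ℕ} (hd : 3 ≤ d) (c : ℝ) (x : Zd d) : Pop (fun _ => c) x = c := by
  unfold Pop
  have : (d : ℝ) ≠ 0 := by positivity
  simp
  field_simp
  ring

lemma Pop_sub {d : ℕ} (φ ψ : Zd d → ℝ) (x : Zd d) :
    Pop (fun y => φ y - ψ y) x = Pop φ x - Pop ψ x := by
  unfold Pop
  rw [← sub_div, ← Finset.sum_sub_distrib]
  congr 1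
  exact Finset.sum_congr rfl fun i _ => by ring

lemma Pop_tendsto {d : ℕ} {φ : ℕ → Zd d → ℝ} {ψ : Zd d → ℝ}
    (h : ∀ x, Filter.Tendsto (fun n => φ n x) Filter.atTop (nhds (ψ x))) (x : Zd d) :
    Filter.Tendsto (fun n => Pop (φ n) x) Filter.atTop (nhds (Pop ψ x)) := by
  unfold Pop
  exact (tendsto_finsetSum _ fun i _ => (h _).add (h _)).div_const _

/-- Lyapunov function -/
noncomputable def lyf {d : ℕ} (x : Zd d) : ℝ := ((∑ i, ((x i : ℝ)) ^ 2) + 400) ^ (-(1/4) : ℝ)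

lemma lyf_pos {d : ℕ} (x : Zd d) : 0 < lyf x := by
  unfold lyf; positivity

lemma quart_ineq (s : ℝ) (h1 : -(1/10) ≤ s) (h2 : s ≤ 1/10) :
    1 ≤ (1 + s) * (1 - s/4 + 3/16 * s^2) ^ 4 := by
  have key : (1 + s) * (1 - s/4 + 3/16 * s^2) ^ 4 = 1 + s^2 * (1/8 + s/2
      + s^2 * (-69/256 + 61/256 * s) + s^4 * (-159/2048 + 135/4096 * s)
      + s^6 * (-351/65536 + 81/65536 * s)) := by ring
  have s2 : s^2 ≤ 1/100 := by nlinarith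
  have s2' : 0 ≤ s^2 := by positivity
  have s4 : s^4 ≤ 1/100 := by nlinarith
  have s4' : 0 ≤ s^4 := by positivity
  have s6 : s^6 ≤ 1/100 := by nlinarith
  have s6' : 0 ≤ s^6 := by positivity
  have e1 : -(1/100) ≤ s^2 * (-69/256 + 61/256 * s) := by nlinarith
  have e2 : -(1/100) ≤ s^4 * (-159/2048 + 135/4096 * s) := by nlinarith
  have e3 : -(1/100) ≤ s^6 * (-351/65536 + 81/65536 * s) := by nlinarith
  rw [key]
  have : 0 ≤ s^2 * (1/8 + s/2
      + s^2 * (-69/256 + 61/256 * s) + s^4 * (-159/2048 + 135/4096 * s)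
      + s^6 * (-351/65536 + 81/65536 * s)) := mul_nonneg s2' (by linarith)
  linarith

lemma rpow_quart (s : ℝ) (h1 : -(1/10) ≤ s) (h2 : s ≤ 1/10) :
    (1 + s) ^ (-(1/4) : ℝ) ≤ 1 - s/4 + 3/16 * s^2 := by
  have hs : 0 < 1 + s := by linarith
  have hq : 0 < 1 - s/4 + 3/16 * s^2 := by nlinarith
  have h := quart_ineq s h1 h2
  have h3 : ((1 + s) ^ (-(1/4) : ℝ)) ^ 4 = (1 + s)⁻¹ := by
    rw [← Real.rpow_natCast, ← Real.rpow_mul hs.le]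
    norm_num
    rw [Real.rpow_neg_one]
  have h4 : ((1 + s) ^ (-(1/4) : ℝ)) ^ 4 ≤ (1 - s/4 + 3/16 * s^2) ^ 4 := by
    rw [h3, inv_le_iff_one_le_mul₀ hs]
    linarith
  exact le_of_pow_le_pow_left₀ (by norm_num) hq.le h4

lemma lyf_pair (v t : ℝ) (hv : 0 < v) (ht : 10 * |t| ≤ v) :
    (v + t) ^ (-(1/4) : ℝ) + (v - t) ^ (-(1/4) : ℝ) ≤
      v ^ (-(1/4) : ℝ) * (2 + 3/8 * (t^2 / v^2)) := by
  have hb := abs_le.1 (show |t| ≤ v / 10 by linarith)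
  have e1 : v + t = v * (1 + t / v) := by field_simp
  have e2 : v - t = v * (1 + -(t / v)) := by field_simp; ring
  have b1 : t / v ≤ 1/10 := by rw [div_le_iff₀ hv]; linarith
  have b2 : -(1/10) ≤ t / v := by rw [le_div_iff₀ hv]; linarith
  rw [e1, e2, Real.mul_rpow hv.le (by linarith), Real.mul_rpow hv.le (by linarith), ← mul_add]
  have q1 := rpow_quart (t / v) b2 b1
  have q2 := rpow_quart (-(t / v)) (by linarith) (by linarith)
  have : 0 < v ^ (-(1/4) : ℝ) := by positivity
  refine mul_le_mul_of_nonneg_left ?_ this.le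
  have e3 : t^2/v^2 = (t/v)^2 := by ring
  rw [e3]
  nlinarith

lemma sq_add {d : ℕ} (x : Zd d) (i : Fin d) (ε : ℤ) :
    (∑ j, ((((x + Pi.single i ε : Zd d) j : ℤ) : ℝ)) ^ 2) =
      (∑ j, ((x j : ℝ)) ^ 2) + (2 * x i * ε + ε^2) := by
  have : ∀ j, ((((x + Pi.single i ε : Zd d) j : ℤ) : ℝ)) ^ 2 =
    ((x j : ℝ)) ^ 2 + (if j = i then (2 * (x i : ℝ) * ε + (ε : ℝ)^2) else 0) := by
    intro j
    by_cases h : j = i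
    · subst h; simp; ring
    · simp [h]
  simp_rw [this]
  rw [Finset.sum_add_distrib]
  simp

lemma lyf_super {d : ℕ} (hd : 3 ≤ d) (x : Zd d) : Pop lyf x ≤ lyf x := by
  set R : ℝ := ∑ j, ((x j : ℝ)) ^ 2 with hR
  have hR0 : 0 ≤ R := by positivity
  set v : ℝ := R + 401 with hv
  have hvpos : 0 < v := by positivity
  have hd' : (3 : ℝ) ≤ d := by exact_mod_cast hd
  have e1 : ∀ i, lyf (x + Pi.single i 1) = (v + 2 * x i) ^ (-(1/4) : ℝ) := by
    intro i
    unfold lyf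
    rw [sq_add, ← hR, hv]
    congr 1; push_cast; ring
  have e2 : ∀ i, lyf (x - Pi.single i 1) = (v - 2 * x i) ^ (-(1/4) : ℝ) := by
    intro i
    unfold lyf
    have : x - Pi.single i 1 = x + Pi.single i (-1) := by
      rw [Pi.single_neg]; abel
    rw [this, sq_add, ← hR, hv]
    congr 1; push_cast; ring
  have e3 : ∀ i, lyf (x + Pi.single i 1) + lyf (x - Pi.single i 1) ≤
      v ^ (-(1/4) : ℝ) * (2 + 3/8 * ((2 * (x i : ℝ))^2 / v^2)) := by
    intro i
    rw [e1, e2]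
    apply lyf_pair _ _ hvpos
    have hi : ((x i : ℝ))^2 ≤ R :=
      Finset.single_le_sum (f := fun j => ((x j : ℝ)) ^ 2) (fun j _ => by positivity)
        (Finset.mem_univ i)
    rw [abs_mul]
    have : |(x i : ℝ)|^2 ≤ R := by rwa [sq_abs]
    simp only [abs_two]
    nlinarith [sq_nonneg (|(x i : ℝ)| - 20)]
  have e4 : (1 - 1/v) ^ (-(1/4) : ℝ) ≥ 1 + (1/4) / v := by
    have h1v : 1 / v < 1 := by rw [div_lt_one hvpos]; linarith
    have h0 : 0 < 1 / v := by positivity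
    have := rpow_one_add_le_one_add_mul_self (s := -(1/v)) (p := 1/4) (by linarith)
      (by norm_num) (by norm_num)
    rw [← sub_eq_add_neg] at this
    have hp : 0 < (1 - 1/v) ^ (1/4 : ℝ) := Real.rpow_pos_of_pos (by linarith) _
    rw [Real.rpow_neg (by linarith), ge_iff_le, le_inv_comm₀ (by positivity) hp]
    refine this.trans ?_
    rw [← one_div, le_div_iff₀ (by positivity)]
    have : (1/4)/v = 1/4 * (1/v) := by ring
    rw [this]
    nlinarith
  have e5 : lyf x = v ^ (-(1/4) : ℝ) * (1 - 1/v) ^ (-(1/4) : ℝ) := by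
    have h1v : 1 / v < 1 := by rw [div_lt_one hvpos]; linarith
    rw [← Real.mul_rpow hvpos.le (by linarith)]
    unfold lyf
    congr 1
    field_simp
    rw [hv]; ring
  unfold Pop
  rw [div_le_iff₀ (by positivity)]
  calc _ ≤ ∑ i, v ^ (-(1/4) : ℝ) * (2 + 3/8 * ((2 * (x i : ℝ))^2 / v^2)) :=
        Finset.sum_le_sum fun i _ => e3 i
    _ = v ^ (-(1/4) : ℝ) * (2 * d + 3/2 * (R / v^2)) := by
        rw [← Finset.mul_sum, Finset.sum_add_distrib, ← Finset.mul_sum, ← Finset.sum_div]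
        simp_rw [mul_pow]
        rw [← Finset.mul_sum, ← hR]
        simp
        left; ring
    _ ≤ v ^ (-(1/4) : ℝ) * ((1 + (1/4) / v) * (2 * d)) := by
        gcongr
        have : R / v^2 ≤ 1 / v := by
          rw [div_le_div_iff₀ (by positivity) hvpos]; nlinarith
        have h3 : 0 < 1/v := by positivity
        have : (1 + (1/4) / v) * (2 * d) = 2 * d + d / 2 * (1 / v) := by field_simp; ring
        nlinarith
    _ ≤ _ := by
        rw [e5, mul_assoc]
        gcongr

lemma lyf_finite {d : ℕ} (ε : ℝ) (hε : 0 < ε) : {x : Zd d | ε ≤ lyf x}.Finite := by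
  obtain ⟨N, hN⟩ := exists_nat_gt ((ε⁻¹)^4)
  refine (Set.finite_Icc (fun _ => -(N : ℤ) : Zd d) (fun _ => (N : ℤ))).subset ?_
  intro x hx
  simp only [mem_ofPred_eq] at hx
  set R : ℝ := ∑ j, ((x j : ℝ)) ^ 2 with hR
  have hR0 : 0 ≤ R := by positivity
  have h1 : lyf x ^ 4 = (R + 400)⁻¹ := by
    unfold lyf
    rw [← Real.rpow_natCast, ← Real.rpow_mul (by positivity)]
    norm_num
    rw [Real.rpow_neg_one]
  have h2 : ε ^ 4 ≤ (R + 400)⁻¹ := by rw [← h1]; gcongr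
  have h3 : R + 400 ≤ (ε⁻¹)^4 := by
    rw [inv_pow]
    exact (le_inv_comm₀ (by positivity) (by positivity)).1 h2
  have hb : ∀ i, |x i| ≤ N := by
    intro i
    have hi : ((x i : ℝ))^2 ≤ R :=
      Finset.single_le_sum (f := fun j => ((x j : ℝ)) ^ 2) (fun j _ => by positivity)
        (Finset.mem_univ i)
    have hi' : ((x i)^2 : ℤ) < N := by
      have : (((x i)^2 : ℤ) : ℝ) < ((N : ℤ) : ℝ) := by push_cast; linarith
      exact_mod_cast this
    have : |x i| ≤ (x i)^2 := by
      rw [← sq_abs]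
      rcases (abs_nonneg (x i)).eq_or_lt with h | h <;> nlinarith
    linarith
  exact ⟨fun i => (abs_le.1 (hb i)).1, fun i => (abs_le.1 (hb i)).2⟩

/-- Liouville: nonnegative harmonic function dominated by the Lyapunov function vanishes. -/
lemma harm_zero {d : ℕ} (hd : 3 ≤ d) (k : Zd d → ℝ) (C : ℝ) (hC : 0 < C) (h0 : ∀ x, 0 ≤ k x)
    (hk : ∀ x, Pop k x = k x) (hle : ∀ x, k x ≤ C * lyf x) (x : Zd d) : k x = 0 := by
  by_contra hne
  have hpos : 0 < k x := lt_of_le_of_ne (h0 x) (Ne.symm hne)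
  have hfin : ∀ a : ℝ, 0 < a → {y : Zd d | a ≤ k y}.Finite := by
    intro a ha
    refine (lyf_finite (a / C) (by positivity)).subset ?_
    intro y hy
    simp only [mem_ofPred_eq] at hy ⊢
    rw [div_le_iff₀ hC]
    linarith [hle y]
  obtain ⟨m, hm, hmax⟩ := Set.exists_max_image _ k (hfin _ hpos) ⟨x, le_refl (k x)⟩
  simp only [mem_ofPred_eq] at hm hmax
  have hmax' : ∀ y, k y ≤ k m := by
    intro y
    by_cases hy : k x ≤ k y
    · exact hmax y hy
    · linarith
  let i0 : Fin d := ⟨0, by omega⟩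
  have step : ∀ y, k y = k m → k (y + Pi.single i0 1) = k m := by
    intro y hy
    by_contra hlt
    have hlt' : k (y + Pi.single i0 1) < k m := lt_of_le_of_ne (hmax' _) hlt
    have h1 : Pop k y < Pop (fun _ => k m) y := by
      unfold Pop
      have : (0 : ℝ) < 2 * d := by positivity
      rw [div_lt_div_iff_of_pos_right this]
      refine Finset.sum_lt_sum (fun i _ => add_le_add (hmax' _) (hmax' _)) ⟨i0, Finset.mem_univ _, ?_⟩
      exact add_lt_add_of_lt_of_le hlt' (hmax' _)
    rw [Pop_const hd, hk, hy] at h1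
    exact lt_irrefl _ h1
  have all : ∀ n : ℕ, k (m + Pi.single i0 (n : ℤ)) = k m := by
    intro n
    induction n with
    | zero => simp
    | succ n ih =>
      have := step _ ih
      rw [add_assoc, ← Pi.single_add] at this
      push_cast
      exact this
  have hinf : Set.Infinite {y : Zd d | k x ≤ k y} := by
    refine Set.infinite_of_injective_forall_mem (f := fun n : ℕ => m + Pi.single i0 (n : ℤ)) ?_ ?_
    · intro a b hab
      have := congrFun hab i0
      simpa using this
    · intro n
      simp only [mem_ofPred_eq, all n]
      exact hm
  exact hinf (hfin _ hpos)

end Aux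
end Disconnection

namespace Disconnection
namespace Aux

/-- probability of avoiding `A` up to step `n` -/
noncomputable def qn {d : ℕ} (A : Set (Zd d)) : ℕ → Zd d → ℝ
  | 0 => fun x => if x ∈ A then 0 else 1
  | n + 1 => fun x => if x ∈ A then 0 else Pop (qn A n) x

/-- probability of avoiding `A` forever -/
noncomputable def qi {d : ℕ} (A : Set (Zd d)) (x : Zd d) : ℝ := ⨅ n, qn A n x

/-- probability of hitting `A` -/
noncomputable def hh {d : ℕ} (A : Set (Zd d)) (x : Zd d) : ℝ := 1 - qi A x

/-- function version of the equilibrium measure -/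
noncomputable def ee {d : ℕ} (A : Set (Zd d)) (x : Zd d) : ℝ := if x ∈ A then Pop (qi A) x else 0

variable {d : ℕ} (A : Set (Zd d))

lemma qn_nonneg (n : ℕ) (x : Zd d) : 0 ≤ qn A n x := by
  induction n generalizing x with
  | zero => unfold qn; split_ifs <;> norm_num
  | succ n ih => unfold qn; split_ifs; exacts [le_rfl, Pop_nonneg ih x]

lemma qn_zero_le (x : Zd d) : qn A 0 x ≤ 1 := by unfold qn; split_ifs <;> norm_num

lemma qn_anti_succ (hd : 3 ≤ d) (n : ℕ) (x : Zd d) : qn A (n+1) x ≤ qn A n x := by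
  induction n generalizing x with
  | zero =>
    unfold qn; split_ifs
    · exact le_rfl
    · exact (Pop_mono (qn_zero_le A) x).trans (Pop_const hd 1 x).le
  | succ n ih =>
    show (if x ∈ A then 0 else Pop (qn A (n+1)) x) ≤ (if x ∈ A then 0 else Pop (qn A n) x)
    split_ifs
    · exact le_rfl
    · exact Pop_mono ih x

lemma qn_anti (hd : 3 ≤ d) (x : Zd d) : Antitone (fun n => qn A n x) :=
  antitone_nat_of_succ_le fun n => qn_anti_succ A hd n x

lemma qn_le_one (hd : 3 ≤ d) (n : ℕ) (x : Zd d) : qn A n x ≤ 1 :=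
  (qn_anti A hd x (Nat.zero_le n)).trans (qn_zero_le A x)

lemma qn_tendsto (hd : 3 ≤ d) (x : Zd d) :
    Filter.Tendsto (fun n => qn A n x) Filter.atTop (nhds (qi A x)) :=
  tendsto_atTop_ciInf (qn_anti A hd x) ⟨0, by rintro _ ⟨n, rfl⟩; exact qn_nonneg A n x⟩

lemma qi_nonneg (x : Zd d) : 0 ≤ qi A x := le_ciInf fun n => qn_nonneg A n x

lemma qi_le_one (hd : 3 ≤ d) (x : Zd d) : qi A x ≤ 1 :=
  le_of_tendsto' (qn_tendsto A hd x) (fun n => qn_le_one A hd n x)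

lemma qi_of_mem (hd : 3 ≤ d) (x : Zd d) (hx : x ∈ A) : qi A x = 0 := by
  refine tendsto_nhds_unique (qn_tendsto A hd x) ?_
  have : (fun n => qn A n x) = fun _ => 0 := by
    funext n; cases n <;> simp [qn, hx]
  rw [this]; exact tendsto_const_nhds

lemma qi_of_notMem (hd : 3 ≤ d) (x : Zd d) (hx : x ∉ A) : qi A x = Pop (qi A) x := by
  refine tendsto_nhds_unique ((Filter.tendsto_add_atTop_iff_nat 1).2 (qn_tendsto A hd x)) ?_
  have : (fun n => qn A (n+1) x) = fun n => Pop (qn A n) x := by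
    funext n; simp [qn, hx]
  rw [this]; exact Pop_tendsto (qn_tendsto A hd) x

lemma hh_nonneg (hd : 3 ≤ d) (x : Zd d) : 0 ≤ hh A x := by
  have := qi_le_one A hd x; unfold hh; linarith

lemma hh_le_one (x : Zd d) : hh A x ≤ 1 := by
  have := qi_nonneg A x; unfold hh; linarith

lemma hh_of_mem (hd : 3 ≤ d) (x : Zd d) (hx : x ∈ A) : hh A x = 1 := by
  unfold hh; rw [qi_of_mem A hd x hx]; simp

lemma Pop_hh (hd : 3 ≤ d) (x : Zd d) : Pop (hh A) x = hh A x - ee A x := by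
  have h1 : Pop (hh A) x = 1 - Pop (qi A) x := by
    have := Pop_sub (fun _ => (1:ℝ)) (qi A) x
    rw [Pop_const hd] at this
    exact this
  rw [h1]
  unfold ee hh
  split_ifs with hx
  · rw [qi_of_mem A hd x hx]; ring
  · rw [← qi_of_notMem A hd x hx]; ring

lemma ee_nonneg (x : Zd d) : 0 ≤ ee A x := by
  unfold ee; split_ifs; exacts [Pop_nonneg (qi_nonneg A) x, le_rfl]

lemma exists_bound (hd : 3 ≤ d) (hA : A.Finite) :
    ∃ C : ℝ, 0 < C ∧ ∀ x, hh A x ≤ C * lyf x := by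
  obtain ⟨C, hC, hCA⟩ : ∃ C : ℝ, 0 < C ∧ ∀ x ∈ A, 1 ≤ C * lyf x := by
    refine ⟨1 + ∑ x ∈ hA.toFinset, (lyf x)⁻¹, ?_, ?_⟩
    · have : 0 ≤ ∑ x ∈ hA.toFinset, (lyf x)⁻¹ :=
        Finset.sum_nonneg fun x _ => (inv_pos.2 (lyf_pos x)).le
      linarith
    · intro x hx
      have : (lyf x)⁻¹ ≤ ∑ x ∈ hA.toFinset, (lyf x)⁻¹ :=
        Finset.single_le_sum (f := fun x => (lyf x)⁻¹) (fun y _ => (inv_pos.2 (lyf_pos y)).le)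
          (hA.mem_toFinset.2 hx)
      have h2 := lyf_pos x
      calc (1:ℝ) = (lyf x)⁻¹ * lyf x := by field_simp
        _ ≤ _ := by gcongr; linarith
  refine ⟨C, hC, ?_⟩
  have key : ∀ n x, 1 - qn A n x ≤ C * lyf x := by
    intro n
    induction n with
    | zero =>
      intro x
      by_cases hx : x ∈ A
      · simpa [qn, hx] using hCA x hx
      · have := lyf_pos x
        simp [qn, hx]; positivity
    | succ n ih =>
      intro x
      by_cases hx : x ∈ A
      · simpa [qn, hx] using hCA x hx
      · simp only [qn, hx, if_false]
        have h1 := Pop_sub (fun _ => (1:ℝ)) (qn A n) x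
        rw [Pop_const hd] at h1
        rw [← h1]
        refine (Pop_mono ih x).trans ?_
        rw [Pop_smul]
        exact mul_le_mul_of_nonneg_left (lyf_super hd x) hC.le
  intro x
  exact le_of_tendsto' ((qn_tendsto A hd x).const_sub 1) (fun n => key n x)

lemma exists_ee_pos (hd : 3 ≤ d) (hA : A.Finite) (hne : A.Nonempty) : ∃ x ∈ A, 0 < ee A x := by
  by_contra hcon
  push Not at hcon
  obtain ⟨C, hC, hb⟩ := exists_bound A hd hA
  have hz : ∀ x, ee A x = 0 := by
    intro x
    by_cases hx : x ∈ A
    · exact le_antisymm (hcon x hx) (ee_nonneg A x)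
    · simp [ee, hx]
  obtain ⟨a, ha⟩ := hne
  have := harm_zero hd (hh A) C hC (hh_nonneg A hd) (fun x => by rw [Pop_hh A hd, hz, sub_zero]) hb a
  rw [hh_of_mem A hd a ha] at this
  norm_num at this

/-- iterates of the operator on `hh` -/
noncomputable def hit {d : ℕ} (A : Set (Zd d)) : ℕ → Zd d → ℝ
  | 0 => hh A
  | n + 1 => Pop (hit A n)

lemma hit_nonneg (hd : 3 ≤ d) (n : ℕ) (x : Zd d) : 0 ≤ hit A n x := by
  induction n generalizing x with
  | zero => exact hh_nonneg A hd x
  | succ n ih => exact Pop_nonneg ih x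

lemma hit_succ_le (hd : 3 ≤ d) (n : ℕ) (x : Zd d) : hit A (n+1) x ≤ hit A n x := by
  induction n generalizing x with
  | zero =>
    have := Pop_hh A hd x
    have h2 := ee_nonneg A x
    simp only [hit]; linarith
  | succ n ih => exact Pop_mono ih x

lemma hit_tendsto (hd : 3 ≤ d) (hA : A.Finite) (x : Zd d) :
    Filter.Tendsto (fun n => hit A n x) Filter.atTop (nhds 0) := by
  obtain ⟨C, hC, hb⟩ := exists_bound A hd hA
  have hanti : ∀ x, Antitone fun n => hit A n x :=
    fun x => antitone_nat_of_succ_le fun n => hit_succ_le A hd n x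
  have ht : ∀ x, Filter.Tendsto (fun n => hit A n x) Filter.atTop (nhds (⨅ n, hit A n x)) :=
    fun x => tendsto_atTop_ciInf (hanti x) ⟨0, by rintro _ ⟨n, rfl⟩; exact hit_nonneg A hd n x⟩
  have := harm_zero hd (fun x => ⨅ n, hit A n x) C hC
    (fun x => le_ciInf fun n => hit_nonneg A hd n x) ?_ ?_ x
  · have h := ht x
    rwa [this] at h
  · intro x
    refine tendsto_nhds_unique (Pop_tendsto ht x) ?_
    exact (Filter.tendsto_add_atTop_iff_nat 1).2 (ht x)
  · intro x
    exact (le_of_tendsto' (ht x) (fun n => hanti x (Nat.zero_le n))).trans (hb x)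

end Aux
end Disconnection

namespace Disconnection
namespace Aux

lemma lintegral_expMeasure (F : ℝ → ℝ≥0∞) :
    ∫⁻ t, F t ∂expMeasure = ∫⁻ t in Ioi (0:ℝ), ENNReal.ofReal (Real.exp (-t)) * F t := by
  unfold expMeasure
  have hm : Measurable fun t : ℝ => ENNReal.ofReal (if 0 < t then Real.exp (-t) else 0) := by
    refine ENNReal.measurable_ofReal.comp (Measurable.ite measurableSet_Ioi ?_ measurable_const)
    fun_prop
  rw [lintegral_withDensity_eq_lintegral_mul_non_measurable _ hm (by simp),
    ← lintegral_indicator measurableSet_Ioi]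
  congr 1
  funext t
  by_cases ht : 0 < t <;> simp [ht, indicator]

lemma lintegral_exp_laplace (a : ℝ) (ha : 0 ≤ a) :
    ∫⁻ t, ENNReal.ofReal (Real.exp (-(a * t))) ∂expMeasure = ENNReal.ofReal (1 / (1 + a)) := by
  rw [lintegral_expMeasure]
  have h1 : ∀ t : ℝ, ENNReal.ofReal (Real.exp (-t)) * ENNReal.ofReal (Real.exp (-(a * t))) =
      ENNReal.ofReal (Real.exp (-(1 + a) * t)) := by
    intro t
    rw [← ENNReal.ofReal_mul (Real.exp_nonneg _), ← Real.exp_add]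
    congr 2; ring
  simp_rw [h1]
  rw [← ofReal_integral_eq_lintegral_ofReal (integrableOn_exp_mul_Ioi (by linarith) 0)
    (Filter.Eventually.of_forall fun t => Real.exp_nonneg _), integral_exp_mul_Ioi (by linarith)]
  congr 1
  have : 1 + a ≠ 0 := by linarith
  simp only [mul_zero, Real.exp_zero]
  field_simp

instance : IsProbabilityMeasure expMeasure := ⟨by
  have := lintegral_exp_laplace 0 le_rfl
  simpa using this⟩

lemma lintegral_exp_id (c : ℝ) (hc : 0 ≤ c) :
    ∫⁻ t, ENNReal.ofReal (c * t) ∂expMeasure = ENNReal.ofReal c := by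
  simp_rw [ENNReal.ofReal_mul hc]
  rw [lintegral_const_mul _ (by fun_prop), lintegral_expMeasure]
  have h1 : ∫⁻ t in Ioi (0:ℝ), ENNReal.ofReal (Real.exp (-t)) * ENNReal.ofReal t = 1 := by
    have h2 : ∫⁻ t in Ioi (0:ℝ), ENNReal.ofReal (Real.exp (-t)) * ENNReal.ofReal t =
      ∫⁻ t in Ioi (0:ℝ), ENNReal.ofReal (Real.exp (-t) * t ^ ((2:ℝ) - 1)) := by
      congr 1; funext t
      rw [← ENNReal.ofReal_mul (Real.exp_nonneg _)]
      norm_num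
    rw [h2, ← ofReal_integral_eq_lintegral_ofReal (Real.GammaIntegral_convergent (by norm_num)),
      ← Real.Gamma_eq_integral (by norm_num)]
    · simp
    · refine (ae_restrict_iff' measurableSet_Ioi).2 (Filter.Eventually.of_forall fun t ht => ?_)
      have : (0:ℝ) < t := ht
      simp only [Pi.zero_apply]
      positivity
  rw [h1, mul_one]

lemma expMeasure_Ioi : expMeasure (Ioi 0)ᶜ = 0 := by
  have := lintegral_expMeasure ((Ioi (0:ℝ))ᶜ.indicator 1)
  rw [lintegral_indicator_one measurableSet_Ioi.compl] at this
  rw [this]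
  rw [← lintegral_zero (μ := volume.restrict (Ioi (0:ℝ)))]
  refine setLIntegral_congr_fun measurableSet_Ioi fun t ht => ?_
  have : (0:ℝ) < t := ht
  simp [indicator, this]

/-- the law of one step -/
noncomputable def stepM (d : ℕ) : Measure (Zd d) :=
  ∑ i, ((2 * d : ℕ) : ℝ≥0∞)⁻¹ • (Measure.dirac (Pi.single i 1) + Measure.dirac (Pi.single i (-1)))

lemma lintegral_stepM (d : ℕ) (hd : 3 ≤ d) (x : Zd d) (w : Zd d → ℝ) (hw : ∀ y, 0 ≤ w y) :
    ∫⁻ v, ENNReal.ofReal (w (x + v)) ∂stepM d = ENNReal.ofReal (Pop w x) := by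
  unfold stepM Pop
  rw [lintegral_finsetSum_measure]
  simp_rw [lintegral_smul_measure, lintegral_add_measure, lintegral_dirac]
  have hd' : (0 : ℝ) < 2 * d := by positivity
  rw [ENNReal.ofReal_div_of_pos hd', ENNReal.ofReal_sum_of_nonneg (fun i _ => add_nonneg (hw _) (hw _)),
    ENNReal.div_eq_inv_mul, Finset.mul_sum]
  refine Finset.sum_congr rfl fun i _ => ?_
  rw [ENNReal.ofReal_add (hw _) (hw _), Pi.single_neg, ← sub_eq_add_neg, smul_eq_mul]
  congr 2
  rw [show (2 * (d:ℝ)) = ((2 * d : ℕ) : ℝ) by push_cast; ring, ENNReal.ofReal_natCast]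

lemma stepM_prob {d : ℕ} (hd : 3 ≤ d) : IsProbabilityMeasure (stepM d) := ⟨by
  have := lintegral_stepM d hd 0 (fun _ => 1) (fun _ => zero_le_one)
  rw [Pop_const hd] at this
  simpa using this⟩

lemma natAbs_sum_single {d : ℕ} (i : Fin d) (ε : ℤ) :
    (∑ j, ((Pi.single i ε : Zd d) j).natAbs) = ε.natAbs := by
  rw [Finset.sum_eq_single i]
  · simp
  · intro j _ hj; simp [hj]
  · simp

lemma unit_vec {d : ℕ} (v : Zd d) (h : (∑ i, (v i).natAbs) = 1) :
    ∃ i ε, (ε = 1 ∨ ε = -1) ∧ v = Pi.single i ε := by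
  have hpos : ∃ i, v i ≠ 0 := by
    by_contra hcon
    push Not at hcon
    simp [hcon] at h
  obtain ⟨i, hi⟩ := hpos
  have h2 := Finset.add_sum_erase Finset.univ (fun j => (v j).natAbs) (Finset.mem_univ i)
  rw [h] at h2
  have h1 : 0 < (v i).natAbs := Int.natAbs_pos.2 hi
  have h3 : ∑ j ∈ Finset.univ.erase i, (v j).natAbs = 0 := by omega
  have h4 : (v i).natAbs = 1 := by omega
  rw [Finset.sum_eq_zero_iff] at h3
  refine ⟨i, v i, by omega, ?_⟩
  funext j
  by_cases hj : j = i
  · subst hj; simp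
  · have := h3 j (by simp [hj])
    simp [hj]; omega

lemma stepM_singleton {d : ℕ} (v : Zd d) : stepM d {v} = stepP d v := by
  unfold stepM stepP
  simp only [Measure.finsetSum_apply, Measure.smul_apply, Measure.add_apply, smul_eq_mul,
    Measure.dirac_apply' _ (measurableSet_singleton v)]
  split_ifs with h
  · obtain ⟨i, ε, hε, rfl⟩ := unit_vec v h
    rw [Finset.sum_eq_single i]
    · rcases hε with rfl | rfl
      · have : (Pi.single i (-1) : Zd d) ≠ Pi.single i 1 := by
          intro h; have := congrFun h i; simp at this
        simp [indicator, this]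
      · have : (Pi.single i 1 : Zd d) ≠ Pi.single i (-1) := by
          intro h; have := congrFun h i; simp at this
        simp [indicator, this]
    · intro j _ hj
      have : ∀ δ : ℤ, (Pi.single j δ : Zd d) ≠ Pi.single i ε := by
        intro δ h; have := congrFun h i; simp [Ne.symm hj] at this; omega
      simp [indicator, this]
    · simp
  · refine Finset.sum_eq_zero fun i _ => ?_
    have h1 : (Pi.single i 1 : Zd d) ≠ v := by
      rintro rfl; apply h; rw [natAbs_sum_single]; rfl
    have h2 : (Pi.single i (-1) : Zd d) ≠ v := by
      rintro rfl; apply h; rw [natAbs_sum_single]; rfl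
    simp [indicator, h1, h2]

end Aux
end Disconnection

namespace Disconnection
namespace Aux

variable {d : ℕ} {Ω : Type*} [MeasurableSpace Ω] (W : SRW d Ω)

/-- law of one (increment, holding time) pair -/
noncomputable def nu (d : ℕ) : Measure (Zd d × ℝ) := (stepM d).prod expMeasure

/-- (increment, holding time) pair -/
def ZZ (n : ℕ) (ω : Ω) : Zd d × ℝ := (W.Y (n+1) ω - W.Y n ω, W.ζ n ω)

/-- history -/
def FF (n : ℕ) (ω : Ω) : Fin n → Zd d × ℝ := fun i => ZZ W i ω

lemma measurable_ZZ (n : ℕ) : Measurable (ZZ W n) :=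
  ((W.measurable_Y _).sub (W.measurable_Y _)).prodMk (W.measurable_ζ n)

lemma measurable_FF (n : ℕ) : Measurable (FF W n) :=
  measurable_pi_lambda _ fun i => measurable_ZZ W i

lemma law_pi (hd : 3 ≤ d) (x : Zd d) (n : ℕ) :
    (W.P x).map (FF W n) = Measure.pi fun _ => nu d := by
  have := stepM_prob hd
  symm
  let C1 : Set (Set (Zd d)) := {S | ∃ s, S = {s}}
  let C2 : Set (Set ℝ) := {I | MeasurableSet I}
  have hC1pi : IsPiSystem C1 := by
    rintro _ ⟨s, rfl⟩ _ ⟨t, rfl⟩ ⟨u, hu1, hu2⟩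
    refine ⟨s, ?_⟩
    simp at hu1 hu2; subst hu1; subst hu2; simp
  have hC1gen : MeasurableSpace.generateFrom C1 = (inferInstance : MeasurableSpace (Zd d)) := by
    apply le_antisymm
    · refine MeasurableSpace.generateFrom_le ?_
      rintro _ ⟨s, rfl⟩
      exact measurableSet_singleton s
    · intro S _
      rw [← Set.biUnion_of_singleton S]
      refine @MeasurableSet.biUnion _ _ (MeasurableSpace.generateFrom C1) _ _ (Set.to_countable S) ?_
      intro s _
      exact MeasurableSpace.measurableSet_generateFrom ⟨s, rfl⟩
  have hC1sp : (stepM d).FiniteSpanningSetsIn C1 := by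
    have : Nonempty (Zd d) := ⟨0⟩
    let f := (exists_surjective_nat (Zd d)).choose
    have hf : Function.Surjective f := (exists_surjective_nat (Zd d)).choose_spec
    exact ⟨fun n => {f n}, fun n => ⟨f n, rfl⟩, fun n => measure_lt_top _ _, by
      ext y; simp only [mem_iUnion, mem_singleton_iff, mem_univ, iff_true]; obtain ⟨n, hn⟩ := hf y; exact ⟨n, hn.symm⟩⟩
  have hC2pi : IsPiSystem C2 := MeasurableSpace.isPiSystem_measurableSet
  have hC2gen : MeasurableSpace.generateFrom C2 = (inferInstance : MeasurableSpace ℝ) :=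
    MeasurableSpace.generateFrom_measurableSet
  have hC2sp : expMeasure.FiniteSpanningSetsIn C2 := expMeasure.toFiniteSpanningSetsIn
  refine Measure.pi_eq_generateFrom (C := fun _ => image2 (· ×ˢ ·) C1 C2) ?_ ?_ ?_ ?_
  · intro _
    exact generateFrom_eq_prod hC1gen hC2gen hC1sp.isCountablySpanning hC2sp.isCountablySpanning
  · intro _
    exact hC1pi.prod hC2pi
  · intro _
    exact hC1sp.prod hC2sp
  · intro s hs
    choose S hS I hI hSI using hs
    choose v hv using hS
    rw [Measure.map_apply (measurable_FF W n)]
    · have := W.law x n v I hI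
      have e : FF W n ⁻¹' univ.pi s = {ω | (∀ i : Fin n, W.Y ((i : ℕ) + 1) ω - W.Y (i : ℕ) ω = v i) ∧
             (∀ i : Fin n, W.ζ (i : ℕ) ω ∈ I i)} := by
        ext ω
        simp only [mem_preimage, mem_pi, mem_univ, true_imp_iff, mem_ofPred_eq, ← hSI, hv, mem_prod,
          FF, ZZ, mem_singleton_iff, forall_and]
      rw [e, this, ← Finset.prod_mul_distrib]
      refine Finset.prod_congr rfl fun i _ => ?_
      rw [← hSI, hv, nu, Measure.prod_prod, stepM_singleton]
    · refine MeasurableSet.univ_pi fun i => ?_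
      rw [← hSI, hv]
      exact (measurableSet_singleton _).prod (hI i)

lemma lintegral_step (hd : 3 ≤ d) (x : Zd d) (n : ℕ) (Φ : (Fin n → Zd d × ℝ) → Zd d × ℝ → ℝ≥0∞)
    (hΦ : Measurable (Function.uncurry Φ)) :
    ∫⁻ ω, Φ (FF W n ω) (ZZ W n ω) ∂W.P x = ∫⁻ ω, ∫⁻ z, Φ (FF W n ω) z ∂nu d ∂W.P x := by
  have := stepM_prob hd
  have : IsProbabilityMeasure (nu d) := by unfold nu; infer_instance
  have hmp := (measurePreserving_piFinSuccAbove (fun _ : Fin (n+1) => nu d) (Fin.last n))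
  have h1 : ∀ ω, (FF W n ω) = fun i => FF W (n+1) ω ((Fin.last n).succAbove i) := by
    intro ω; funext i; simp [FF]
  have h2 : ∀ ω, ZZ W n ω = FF W (n+1) ω (Fin.last n) := fun ω => by simp [FF]
  let G : (Zd d × ℝ) × (Fin n → Zd d × ℝ) → ℝ≥0∞ := fun p => Φ p.2 p.1
  have hG : Measurable G := hΦ.comp measurable_swap
  have e1 : ∫⁻ ω, Φ (FF W n ω) (ZZ W n ω) ∂W.P x =
      ∫⁻ ω, G (MeasurableEquiv.piFinSuccAbove (fun _ => Zd d × ℝ) (Fin.last n) (FF W (n+1) ω)) ∂W.P x := by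
    refine lintegral_congr fun ω => ?_
    rw [h1, h2]
    rfl
  rw [e1, ← lintegral_map (μ := W.P x)
    (f := fun F => G (MeasurableEquiv.piFinSuccAbove (fun _ => Zd d × ℝ) (Fin.last n) F))
    (hG.comp (MeasurableEquiv.measurable _)) (measurable_FF W (n+1)), law_pi W hd, hmp.lintegral_comp hG,
    lintegral_prod_symm _ hG.aemeasurable]
  rw [← lintegral_map (μ := W.P x) (f := fun F => ∫⁻ z, Φ F z ∂nu d) ?_ (measurable_FF W n), law_pi W hd]
  exact hΦ.lintegral_prod_right'

/-- position reconstructed from history -/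
def pos {n : ℕ} (x : Zd d) (F : Fin n → Zd d × ℝ) (k : ℕ) : Zd d :=
  x + ∑ i : Fin n, if (i : ℕ) < k then (F i).1 else 0

lemma pos_FF (n : ℕ) (ω : Ω) (k : ℕ) (hk : k ≤ n) : pos (W.Y 0 ω) (FF W n ω) k = W.Y k ω := by
  unfold pos FF ZZ
  have : ∑ i : Fin n, (if (i : ℕ) < k then W.Y ((i:ℕ)+1) ω - W.Y i ω else 0) =
    ∑ i ∈ Finset.range n, (if i < k then W.Y (i+1) ω - W.Y i ω else 0) :=
    (Finset.sum_range (fun i => if i < k then W.Y (i+1) ω - W.Y i ω else 0)).symm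
  simp only
  rw [this, ← Finset.sum_filter]
  have : Finset.filter (fun i => i < k) (Finset.range n) = Finset.range k := by
    ext i; simp; omega
  rw [this, Finset.sum_range_sub (fun i => W.Y i ω)]
  simp

lemma measurable_pos {n : ℕ} (x : Zd d) (k : ℕ) :
    Measurable fun F : Fin n → Zd d × ℝ => pos x F k := by
  unfold pos
  refine measurable_const.add (Finset.measurable_sum _ fun i _ => ?_)
  split_ifs
  · exact (measurable_pi_apply i).fst
  · exact measurable_const

lemma ae_Y_zero (x : Zd d) : ∀ᵐ ω ∂W.P x, W.Y 0 ω = x := by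
  have := W.isProb x
  have hm : MeasurableSet {ω | W.Y 0 ω = x} := W.measurable_Y 0 (measurableSet_singleton x)
  rw [ae_iff, ← compl_ofPred, prob_compl_eq_zero_iff hm]
  exact W.Y_zero x

lemma markov (hd : 3 ≤ d) (x : Zd d) (n : ℕ) (a : ℕ → Zd d → ℝ → ℝ≥0∞)
    (ha : ∀ k y, Measurable (a k y)) (w : Zd d → ℝ) (hw : ∀ y, 0 ≤ w y) :
    ∫⁻ ω, (∏ k ∈ Finset.range (n+1), a k (W.Y k ω) (W.ζ k ω)) * ENNReal.ofReal (w (W.Y (n+1) ω)) ∂W.P x =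
    ∫⁻ ω, (∏ k ∈ Finset.range n, a k (W.Y k ω) (W.ζ k ω)) *
      ((∫⁻ t, a n (W.Y n ω) t ∂expMeasure) * ENNReal.ofReal (Pop w (W.Y n ω))) ∂W.P x := by
  have := stepM_prob hd
  have ha' : ∀ k, Measurable (Function.uncurry (a k)) := fun k =>
    measurable_from_prod_countable_right (ha k)
  let Φ : (Fin n → Zd d × ℝ) → Zd d × ℝ → ℝ≥0∞ := fun F z =>
    (∏ k : Fin n, a k (pos x F k) (F k).2) *
      (a n (pos x F n) z.2 * ENNReal.ofReal (w (pos x F n + z.1)))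
  have hΦ : Measurable (Function.uncurry Φ) := by
    refine Measurable.mul ?_ (Measurable.mul ?_ ?_)
    · refine Finset.measurable_prod _ fun k _ => ?_
      refine (ha' k).comp (Measurable.prodMk ?_ ?_)
      · exact (measurable_pos x k).comp measurable_fst
      · exact ((measurable_pi_apply k).comp measurable_fst).snd
    · refine (ha' n).comp (Measurable.prodMk ?_ ?_)
      · exact (measurable_pos x n).comp measurable_fst
      · exact measurable_snd.snd
    · refine ENNReal.measurable_ofReal.comp ((measurable_of_countable w).comp ?_)
      exact ((measurable_pos x n).comp measurable_fst).add measurable_snd.fst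
  have key := lintegral_step W hd x n Φ hΦ
  have e1 : ∫⁻ ω, (∏ k ∈ Finset.range (n+1), a k (W.Y k ω) (W.ζ k ω)) *
      ENNReal.ofReal (w (W.Y (n+1) ω)) ∂W.P x = ∫⁻ ω, Φ (FF W n ω) (ZZ W n ω) ∂W.P x := by
    refine lintegral_congr_ae ?_
    filter_upwards [ae_Y_zero W x] with ω hω
    have hpos : ∀ k ≤ n, pos x (FF W n ω) k = W.Y k ω := fun k hk => by
      rw [← hω]; exact pos_FF W n ω k hk
    simp only [Φ]
    rw [hpos n le_rfl, Finset.prod_range_succ, Finset.prod_range, mul_assoc]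
    congr 1
    · refine Finset.prod_congr rfl fun k _ => ?_
      rw [hpos k k.2.le]; rfl
    · simp [ZZ]
  rw [e1, key]
  refine lintegral_congr_ae ?_
  filter_upwards [ae_Y_zero W x] with ω hω
  have hpos : ∀ k ≤ n, pos x (FF W n ω) k = W.Y k ω := fun k hk => by
    rw [← hω]; exact pos_FF W n ω k hk
  simp only [Φ]
  rw [hpos n le_rfl, lintegral_const_mul]
  · rw [Finset.prod_range]
    congr 1
    · refine Finset.prod_congr rfl fun k _ => ?_
      rw [hpos k k.2.le]; rfl
    · have e3 : (fun z : Zd d × ℝ => a n (W.Y n ω) z.2 * ENNReal.ofReal (w (W.Y n ω + z.1))) =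
        fun z => ENNReal.ofReal (w (W.Y n ω + z.1)) * a n (W.Y n ω) z.2 := by
        funext z; rw [mul_comm]
      rw [nu, e3, lintegral_prod_mul (f := fun v => ENNReal.ofReal (w (W.Y n ω + v)))
        (measurable_of_countable _).aemeasurable (ha n _).aemeasurable, lintegral_stepM d hd _ w hw, mul_comm]
  · refine Measurable.mul ((ha n _).comp measurable_snd) ?_
    exact (measurable_of_countable (fun v => ENNReal.ofReal (w (W.Y n ω + v)))).comp measurable_fst

end Aux
end Disconnection

namespace Disconnection
namespace Aux

variable {d : ℕ} {Ω : Type*} [MeasurableSpace Ω] (W : SRW d Ω)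

lemma markov_single (hd : 3 ≤ d) (x : Zd d) (n : ℕ) (b : Zd d → ℝ → ℝ≥0∞)
    (hb : ∀ y, Measurable (b y)) (w : Zd d → ℝ) (hw : ∀ y, 0 ≤ w y) :
    ∫⁻ ω, b (W.Y n ω) (W.ζ n ω) * ENNReal.ofReal (w (W.Y (n+1) ω)) ∂W.P x =
    ∫⁻ ω, (∫⁻ t, b (W.Y n ω) t ∂expMeasure) * ENNReal.ofReal (Pop w (W.Y n ω)) ∂W.P x := by
  have h := markov W hd x n (fun k y t => if k = n then b y t else 1) ?_ w hw
  · have e : ∀ ω, ∏ k ∈ Finset.range n, (if k = n then b (W.Y k ω) (W.ζ k ω) else 1) = 1 := by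
      intro ω
      refine Finset.prod_eq_one fun k hk => ?_
      rw [if_neg (Finset.mem_range.1 hk).ne]
    simp only [Finset.prod_range_succ, e, one_mul, if_true] at h
    exact h
  · intro k y
    by_cases h : k = n
    · simp only [h, if_true]; exact hb y
    · simp only [h, if_false]; exact measurable_const

/-- good paths -/
def Good (ω : Ω) : Prop :=
  (∀ k, 0 < W.ζ k ω) ∧ Filter.Tendsto (fun n => W.S n ω) Filter.atTop Filter.atTop

lemma ae_pos (hd : 3 ≤ d) (x : Zd d) : ∀ᵐ ω ∂W.P x, ∀ k, 0 < W.ζ k ω := by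
  rw [ae_all_iff]
  intro k
  have h := markov_single W hd x k (fun _ => (Ioi (0:ℝ))ᶜ.indicator 1)
    (fun _ => (measurable_const (a := (1 : ℝ≥0∞))).indicator measurableSet_Ioi.compl) (fun _ => 1) (fun _ => zero_le_one)
  have h0 : ∫⁻ t, (Ioi (0:ℝ))ᶜ.indicator 1 t ∂expMeasure = 0 := by
    rw [lintegral_indicator_one measurableSet_Ioi.compl, expMeasure_Ioi]
  simp only [h0, zero_mul, lintegral_zero, ENNReal.ofReal_one, mul_one] at h
  rw [lintegral_eq_zero_iff] at h
  · filter_upwards [h] with ω hω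
    by_contra hc
    simp [indicator, hc] at hω
  · exact ((measurable_const (a := (1 : ℝ≥0∞))).indicator measurableSet_Ioi.compl).comp (W.measurable_ζ k)

lemma lintegral_expS (hd : 3 ≤ d) (x : Zd d) (n : ℕ) :
    ∫⁻ ω, (∏ k ∈ Finset.range n, ENNReal.ofReal (Real.exp (-(1 * W.ζ k ω)))) ∂W.P x =
      (ENNReal.ofReal (1/2)) ^ n := by
  have := W.isProb x
  induction n with
  | zero => simp
  | succ n ih =>
    have h := markov W hd x n (fun k y t => ENNReal.ofReal (Real.exp (-(1 * t)))) (fun k y => by fun_prop)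
      (fun _ => 1) (fun _ => zero_le_one)
    simp only [ENNReal.ofReal_one, mul_one, lintegral_exp_laplace 1 zero_le_one, Pop_const hd] at h
    rw [h, lintegral_mul_const, ih, pow_succ]
    · norm_num
    · refine Finset.measurable_prod _ fun k _ => ?_
      have := W.measurable_ζ k
      fun_prop

lemma ae_good (hd : 3 ≤ d) (x : Zd d) : ∀ᵐ ω ∂W.P x, Good W ω := by
  have := W.isProb x
  have hp := ae_pos W hd x
  have hm : ∀ n, Measurable (fun ω => ∏ k ∈ Finset.range n, ENNReal.ofReal (Real.exp (-(1 * W.ζ k ω)))) := by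
    intro n
    refine Finset.measurable_prod _ fun k _ => ?_
    have := W.measurable_ζ k
    fun_prop
  have h0 : ∫⁻ ω, ⨅ n, (∏ k ∈ Finset.range n, ENNReal.ofReal (Real.exp (-(1 * W.ζ k ω)))) ∂W.P x = 0 := by
    refine le_antisymm ?_ (zero_le)
    have ht : Filter.Tendsto (fun n => (ENNReal.ofReal (1/2)) ^ n) Filter.atTop (nhds 0) := by
      apply ENNReal.tendsto_pow_atTop_nhds_zero_of_lt_one
      rw [ENNReal.ofReal_lt_one]; norm_num
    refine ge_of_tendsto' ht fun n => ?_
    rw [← lintegral_expS W hd x n]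
    exact lintegral_mono fun ω => iInf_le _ n
  rw [lintegral_eq_zero_iff (Measurable.iInf hm)] at h0
  filter_upwards [hp, h0] with ω h1 h2
  refine ⟨h1, ?_⟩
  have hmono : Monotone fun n => W.S n ω := by
    refine monotone_nat_of_le_succ fun n => ?_
    simp only [SRW.S, Finset.sum_range_succ]
    linarith [h1 n]
  rcases tendsto_atTop_of_monotone hmono with h | ⟨l, hl⟩
  · exact h
  · exfalso
    have hle : ∀ n, W.S n ω ≤ l := fun n => hmono.ge_of_tendsto hl n
    have : ENNReal.ofReal (Real.exp (-l)) ≤ ⨅ n, (∏ k ∈ Finset.range n, ENNReal.ofReal (Real.exp (-(1 * W.ζ k ω)))) := by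
      refine le_iInf fun n => ?_
      rw [← ENNReal.ofReal_prod_of_nonneg (fun _ _ => Real.exp_nonneg _), ← Real.exp_sum]
      apply ENNReal.ofReal_le_ofReal
      apply Real.exp_le_exp.2
      have := hle n
      simp only [SRW.S] at this
      simp only [one_mul, Finset.sum_neg_distrib]
      linarith
    simp only [Pi.zero_apply] at h2
    rw [h2] at this
    simp [Real.exp_pos] at this
    exact absurd this (not_le.2 (Real.exp_pos _))

variable {W}

lemma Good.strictMono {ω : Ω} (h : Good W ω) : StrictMono fun n => W.S n ω := by
  refine strictMono_nat_of_lt_succ fun n => ?_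
  simp only [SRW.S, Finset.sum_range_succ]
  linarith [h.1 n]

lemma Good.jumpIdx {ω : Ω} (h : Good W ω) {t : ℝ} {k : ℕ} (h1 : W.S k ω ≤ t)
    (h2 : t < W.S (k+1) ω) : W.jumpIdx t ω = k := by
  unfold SRW.jumpIdx
  have : {j : ℕ | W.S j ω ≤ t} = Iic k := by
    ext j
    simp only [mem_ofPred_eq, mem_Iic]
    constructor
    · intro hj
      have := h.strictMono.lt_iff_lt.1 (hj.trans_lt h2)
      omega
    · intro hj
      exact (h.strictMono.monotone hj).trans h1
  rw [this, csSup_Iic]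

lemma Good.exists_idx {ω : Ω} (h : Good W ω) {t : ℝ} (ht : 0 ≤ t) :
    ∃ k, W.S k ω ≤ t ∧ t < W.S (k+1) ω := by
  have hex : ∃ n, t < W.S n ω := (h.2.eventually_gt_atTop t).exists
  have hf := Nat.find_spec hex
  have h0 : Nat.find hex ≠ 0 := by
    intro h0
    rw [h0] at hf
    simp [SRW.S] at hf
    linarith
  obtain ⟨k, hk⟩ := Nat.exists_eq_succ_of_ne_zero h0
  refine ⟨k, ?_, ?_⟩
  · have := Nat.find_min hex (m := k) (by omega)
    linarith
  · rw [hk] at hf; exact hf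

lemma Good.S_nonneg {ω : Ω} (h : Good W ω) (k : ℕ) : 0 ≤ W.S k ω := by
  have := h.strictMono.monotone (Nat.zero_le k)
  simpa [SRW.S] using this

lemma Good.hitTilde {ω : Ω} (h : Good W ω) (A : Set (Zd d)) :
    W.hitTilde A ω = ⊤ ↔ ∀ n, W.Y (n+1) ω ∉ A := by
  have hS1 : W.S 1 ω = W.ζ 0 ω := by simp [SRW.S]
  unfold SRW.hitTilde SRW.hitFrom
  rw [sInf_eq_top]
  constructor
  · intro H n hn
    have hnn := h.S_nonneg (n+1)
    have := H (((W.S (n+1) ω).toNNReal : ℝ≥0) : ℝ≥0∞) ⟨(W.S (n+1) ω).toNNReal, rfl, ?_, ?_⟩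
    · exact ENNReal.coe_ne_top this
    · rw [← hS1]
      show ENNReal.ofReal _ ≤ ENNReal.ofReal _
      exact ENNReal.ofReal_le_ofReal (h.strictMono.monotone (by omega))
    · rw [Real.coe_toNNReal _ hnn]
      unfold SRW.X
      rwa [h.jumpIdx le_rfl (h.strictMono (Nat.lt_succ_self _))]
  · rintro H _ ⟨s, rfl, hs, hX⟩
    exfalso
    obtain ⟨k, hk1, hk2⟩ := h.exists_idx s.2
    have hs' : W.S 1 ω ≤ s := by
      rw [hS1]
      rw [ENNReal.ofReal_le_iff_le_toReal ENNReal.coe_ne_top] at hs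
      simpa using hs
    have hk : k ≠ 0 := by
      rintro rfl
      have hk2' : (s : ℝ) < W.S (0+1) ω := hk2
      simp only [zero_add] at hk2'
      linarith
    obtain ⟨n, rfl⟩ := Nat.exists_eq_succ_of_ne_zero hk
    unfold SRW.X at hX
    have : W.jumpIdx (s : ℝ) ω = n + 1 := h.jumpIdx hk1 hk2
    rw [this] at hX
    exact H n hX

variable (W)

lemma lintegral_avoid (hd : 3 ≤ d) (A : Set (Zd d)) (x : Zd d) (n j : ℕ) :
    ∫⁻ ω, (∏ k ∈ Finset.range (n+1), (if k ≠ 0 ∧ W.Y k ω ∈ A then (0 : ℝ≥0∞) else 1)) *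
      ENNReal.ofReal (qn A j (W.Y (n+1) ω)) ∂W.P x = ENNReal.ofReal (Pop (qn A (n + j)) x) := by
  have := W.isProb x
  have step : ∀ n j, ∫⁻ ω, (∏ k ∈ Finset.range (n+1), (if k ≠ 0 ∧ W.Y k ω ∈ A then (0 : ℝ≥0∞) else 1)) *
      ENNReal.ofReal (qn A j (W.Y (n+1) ω)) ∂W.P x =
      ∫⁻ ω, (∏ k ∈ Finset.range n, (if k ≠ 0 ∧ W.Y k ω ∈ A then (0 : ℝ≥0∞) else 1)) *
      ((if n ≠ 0 ∧ W.Y n ω ∈ A then (0 : ℝ≥0∞) else 1) * ENNReal.ofReal (Pop (qn A j) (W.Y n ω))) ∂W.P x := by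
    intro n j
    have h := markov W hd x n (fun k y _ => if k ≠ 0 ∧ y ∈ A then (0 : ℝ≥0∞) else 1)
      (fun _ _ => measurable_const) (qn A j) (qn_nonneg A j)
    simpa using h
  induction n generalizing j with
  | zero =>
    rw [step]
    simp only [Finset.range_zero, Finset.prod_empty, one_mul, ne_eq, not_true, false_and, if_false, zero_add]
    have : ∫⁻ ω, ENNReal.ofReal (Pop (qn A j) (W.Y 0 ω)) ∂W.P x =
        ∫⁻ ω, ENNReal.ofReal (Pop (qn A j) x) ∂W.P x := by
      refine lintegral_congr_ae ?_
      filter_upwards [ae_Y_zero W x] with ω hω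
      rw [hω]
    rw [this]; simp
  | succ n ih =>
    rw [step]
    have := ih (j+1)
    rw [show n + 1 + j = n + (j+1) by ring, ← this]
    refine lintegral_congr fun ω => ?_
    congr 1
    simp only [ne_eq, Nat.succ_ne_zero, not_false_eq_true, true_and, qn]
    split_ifs <;> simp

lemma eqm_eq (hd : 3 ≤ d) (A : Set (Zd d)) (x : Zd d) : W.eqm A x = ee A x := by
  have := W.isProb x
  unfold SRW.eqm ee
  split_ifs with hx
  swap
  · rfl
  let B : ℕ → Set Ω := fun n => {ω | ∀ k ∈ Finset.range (n+1), W.Y (k+1) ω ∉ A}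
  have hBm : ∀ n, MeasurableSet (B n) := by
    intro n
    have : B n = ⋂ k ∈ Finset.range (n+1), (W.Y (k+1)) ⁻¹' Aᶜ := by
      ext ω; simp [B]
    rw [this]
    exact Finset.measurableSet_biInter _ fun k _ => W.measurable_Y _ (Set.to_countable _).measurableSet
  have hB : ∀ n, W.P x (B n) = ENNReal.ofReal (Pop (qn A n) x) := by
    intro n
    have h := lintegral_avoid W hd A x n 0
    rw [add_zero] at h
    rw [← h, ← lintegral_indicator_one (hBm n)]
    refine lintegral_congr fun ω => ?_
    have e : (∏ k ∈ Finset.range (n+1), (if k ≠ 0 ∧ W.Y k ω ∈ A then (0 : ℝ≥0∞) else 1)) *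
      ENNReal.ofReal (qn A 0 (W.Y (n+1) ω)) = ∏ k ∈ Finset.range (n+2), (if k ≠ 0 ∧ W.Y k ω ∈ A then (0 : ℝ≥0∞) else 1) := by
      rw [Finset.prod_range_succ _ (n+1)]
      congr 1
      simp only [qn, ne_eq, Nat.succ_ne_zero, not_false_eq_true, true_and]
      split_ifs <;> simp
    rw [e, Finset.prod_range_succ']
    simp only [ne_eq, Nat.succ_ne_zero, not_false_eq_true, true_and, not_true, false_and, if_false, mul_one]
    by_cases hω : ω ∈ B n
    · rw [indicator_of_mem hω, Finset.prod_eq_one]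
      · rfl
      · intro k hk
        rw [if_neg (hω k hk)]
    · rw [indicator_of_notMem hω]
      simp only [B, mem_ofPred_eq] at hω
      push Not at hω
      obtain ⟨k, hk, hk2⟩ := hω
      rw [Finset.prod_eq_zero hk]
      rw [if_pos hk2]
  have hBanti : Antitone B := by
    intro m n hmn ω hω k hk
    exact hω k (Finset.mem_range.2 (by have := Finset.mem_range.1 hk; omega))
  have hlim := tendsto_measure_iInter_atTop (μ := W.P x) (fun n => (hBm n).nullMeasurableSet) hBanti
    ⟨0, measure_ne_top _ _⟩
  have hlim2 : Filter.Tendsto (fun n => W.P x (B n)) Filter.atTop (nhds (ENNReal.ofReal (Pop (qi A) x))) := by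
    simp_rw [hB]
    exact (ENNReal.continuous_ofReal.tendsto _).comp (Pop_tendsto (qn_tendsto A hd) x)
  have heq := tendsto_nhds_unique hlim hlim2
  have : W.P x {ω | W.hitTilde A ω = ⊤} = W.P x (⋂ n, B n) := by
    apply measure_congr
    filter_upwards [ae_good W hd x] with ω hω
    apply propext
    show W.hitTilde A ω = ⊤ ↔ ω ∈ ⋂ n, B n
    rw [hω.hitTilde, mem_iInter]
    constructor
    · intro h n k _; exact h k
    · intro h n; exact h n n (by simp)
  rw [this, heq, ENNReal.toReal_ofReal (Pop_nonneg (qi_nonneg A) x)]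

end Aux
end Disconnection

namespace Disconnection
namespace Aux

lemma moments_ext (μ ν : Measure ℝ) [IsFiniteMeasure μ] [IsFiniteMeasure ν]
    (hμ : ∀ᵐ x ∂μ, x ∈ Icc (0:ℝ) 1) (hν : ∀ᵐ x ∂ν, x ∈ Icc (0:ℝ) 1)
    (h : ∀ n : ℕ, ∫ x, x ^ n ∂μ = ∫ x, x ^ n ∂ν) : μ = ν := by
  have hint : ∀ (ρ : Measure ℝ) [IsFiniteMeasure ρ], (∀ᵐ x ∂ρ, x ∈ Icc (0:ℝ) 1) →
      ∀ g : ℝ → ℝ, Continuous g → Integrable g ρ := by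
    intro ρ _ hρ g hg
    obtain ⟨C, hC⟩ := (isCompact_Icc (a := (0:ℝ)) (b := 1)).exists_bound_of_continuousOn hg.continuousOn
    exact Integrable.of_bound hg.aestronglyMeasurable C (hρ.mono fun x hx => hC x hx)
  have hpoly : ∀ p : Polynomial ℝ, ∫ x, p.eval x ∂μ = ∫ x, p.eval x ∂ν := by
    intro p
    simp_rw [Polynomial.eval_eq_sum_range]
    rw [integral_finsetSum, integral_finsetSum]
    · refine Finset.sum_congr rfl fun i _ => ?_
      rw [integral_const_mul, integral_const_mul, h]
    · intro i _; exact hint ν hν _ (by fun_prop)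
    · intro i _; exact hint μ hμ _ (by fun_prop)
  refine ext_of_forall_integral_eq_of_IsFiniteMeasure fun g => ?_
  by_contra hne
  set D := |∫ x, g x ∂μ - ∫ x, g x ∂ν| with hD
  have hDpos : 0 < D := abs_pos.2 (sub_ne_zero.2 hne)
  set M := μ.real univ + ν.real univ + 1 with hM
  have hMpos : 0 < M := by positivity
  obtain ⟨p, hp⟩ := exists_polynomial_near_of_continuousOn 0 1 g g.continuous.continuousOn (D / M) (by positivity)
  have est : ∀ (ρ : Measure ℝ) [IsFiniteMeasure ρ], (∀ᵐ x ∂ρ, x ∈ Icc (0:ℝ) 1) →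
      |∫ x, g x ∂ρ - ∫ x, p.eval x ∂ρ| ≤ D / M * ρ.real univ := by
    intro ρ _ hρ
    rw [← integral_sub (hint ρ hρ _ g.continuous) (hint ρ hρ _ p.continuous)]
    rw [← Real.norm_eq_abs]
    refine norm_integral_le_of_norm_le_const (hρ.mono fun x hx => ?_)
    rw [Real.norm_eq_abs, abs_sub_comm]
    exact (hp x hx).le
  have e1 := est μ hμ
  have e2 := est ν hν
  rw [hpoly p] at e1
  have e3 : D ≤ D / M * μ.real univ + D / M * ν.real univ := by
    have := abs_sub_le (∫ x, g x ∂μ) (∫ x, p.eval x ∂ν) (∫ x, g x ∂ν)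
    rw [abs_sub_comm (∫ x, p.eval x ∂ν)] at this
    linarith
  have e4 : D / M * M = D := by field_simp
  have e5 : 0 < D / M := by positivity
  nlinarith

lemma laplace_ext (μ ν : Measure ℝ) [IsFiniteMeasure μ] [IsFiniteMeasure ν]
    (hμ : ∀ᵐ x ∂μ, 0 ≤ x) (hν : ∀ᵐ x ∂ν, 0 ≤ x)
    (h : ∀ n : ℕ, ∫⁻ x, ENNReal.ofReal (Real.exp (-((n:ℝ) * x))) ∂μ =
      ∫⁻ x, ENNReal.ofReal (Real.exp (-((n:ℝ) * x))) ∂ν) : μ = ν := by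
  have hE : Measurable fun x : ℝ => Real.exp (-x) := by fun_prop
  have hL : Measurable fun x : ℝ => -Real.log x := by fun_prop
  have hinv : ∀ ρ : Measure ℝ, (ρ.map fun x => Real.exp (-x)).map (fun x => -Real.log x) = ρ := by
    intro ρ
    rw [Measure.map_map hL hE]
    have : ((fun x : ℝ => -Real.log x) ∘ fun x => Real.exp (-x)) = id := by
      funext x; simp
    rw [this, Measure.map_id]
  have hsupp : ∀ ρ : Measure ℝ, (∀ᵐ x ∂ρ, 0 ≤ x) →
      ∀ᵐ y ∂(ρ.map fun x => Real.exp (-x)), y ∈ Icc (0:ℝ) 1 := by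
    intro ρ hρ
    refine (ae_map_iff hE.aemeasurable (p := fun y => y ∈ Icc (0:ℝ) 1) measurableSet_Icc).2 ?_
    filter_upwards [hρ] with x hx
    exact ⟨Real.exp_nonneg _, Real.exp_le_one_iff.2 (by linarith)⟩
  have hmom : ∀ (ρ : Measure ℝ) (n : ℕ), ∫ y, y ^ n ∂(ρ.map fun x => Real.exp (-x)) =
      (∫⁻ x, ENNReal.ofReal (Real.exp (-((n:ℝ) * x))) ∂ρ).toReal := by
    intro ρ n
    rw [integral_map hE.aemeasurable (by fun_prop)]
    rw [← integral_eq_lintegral_of_nonneg_ae (Filter.Eventually.of_forall fun x => Real.exp_nonneg _)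
      (by fun_prop)]
    congr 1; funext x
    rw [← Real.exp_nat_mul]; congr 1; ring
  rw [← hinv μ, ← hinv ν]
  congr 1
  refine moments_ext _ _ (hsupp μ hμ) (hsupp ν hν) fun n => ?_
  rw [hmom, hmom, h]

variable {d : ℕ} {Ω : Type*} [MeasurableSpace Ω] {W : SRW d Ω}

lemma Good.integral {ω : Ω} (h : Good W ω) (g : Zd d → ℝ) (hg : ∀ y, 0 ≤ g y)
    (hs : Summable fun k => g (W.Y k ω) * W.ζ k ω) :
    ∫ s in Ioi (0:ℝ), g (W.X s ω) = ∑' k, g (W.Y k ω) * W.ζ k ω := by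
  rw [← integral_Ici_eq_integral_Ioi]
  have hU : Ici (0:ℝ) = ⋃ k, Ico (W.S k ω) (W.S (k+1) ω) := by
    ext t
    simp only [mem_Ici, mem_iUnion, mem_Ico]
    constructor
    · exact fun ht => h.exists_idx ht
    · rintro ⟨k, hk, _⟩; exact (h.S_nonneg k).trans hk
  have hdisj : Pairwise (Function.onFun Disjoint fun k => Ico (W.S k ω) (W.S (k+1) ω)) := by
    have := h.strictMono.monotone.pairwise_disjoint_on_Ico_succ
    exact this
  have hcongr : ∀ k, EqOn (fun s => g (W.X s ω)) (fun _ => g (W.Y k ω)) (Ico (W.S k ω) (W.S (k+1) ω)) := by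
    intro k s hs
    simp only [SRW.X]
    rw [h.jumpIdx hs.1 hs.2]
  have hval : ∀ k, ∫ s in Ico (W.S k ω) (W.S (k+1) ω), g (W.X s ω) = g (W.Y k ω) * W.ζ k ω := by
    intro k
    rw [setIntegral_congr_fun measurableSet_Ico (hcongr k)]
    have := h.1 k
    have e : W.S (k+1) ω - W.S k ω = W.ζ k ω := by simp [SRW.S, Finset.sum_range_succ]
    simp [e, this.le, mul_comm]
  have hio : ∀ k, IntegrableOn (fun s => g (W.X s ω)) (Ico (W.S k ω) (W.S (k+1) ω)) := by
    intro k
    rw [integrableOn_congr_fun (hcongr k) measurableSet_Ico]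
    exact integrableOn_const (by simp)
  rw [hU, integral_iUnion (fun k => measurableSet_Ico) hdisj]
  · simp_rw [hval]
  · refine integrableOn_iUnion_of_summable_integral_norm hio ?_
    simp_rw [Real.norm_of_nonneg (hg _), hval]
    exact hs

variable (W) (A : Set (Zd d))

lemma lintegral_hit (hd : 3 ≤ d) (x : Zd d) (n j : ℕ) :
    ∫⁻ ω, ENNReal.ofReal (hit A j (W.Y n ω)) ∂W.P x = ENNReal.ofReal (hit A (n + j) x) := by
  have := W.isProb x
  induction n generalizing j with
  | zero =>
    have : ∫⁻ ω, ENNReal.ofReal (hit A j (W.Y 0 ω)) ∂W.P x =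
        ∫⁻ ω, ENNReal.ofReal (hit A j x) ∂W.P x := by
      refine lintegral_congr_ae ?_
      filter_upwards [ae_Y_zero W x] with ω hω
      rw [hω]
    rw [this]; simp
  | succ n ih =>
    have h := markov_single W hd x n (fun _ _ => 1) (fun _ => measurable_const) (hit A j) (hit_nonneg A hd j)
    simp only [one_mul, lintegral_const, measure_univ, mul_one] at h
    rw [h, show n + 1 + j = n + (j+1) by ring, ← ih (j+1)]
    rfl

lemma lintegral_ee (hd : 3 ≤ d) (x : Zd d) (n : ℕ) :
    (∑ k ∈ Finset.range n, ∫⁻ ω, ENNReal.ofReal (ee A (W.Y k ω)) ∂W.P x) + ENNReal.ofReal (hit A n x)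
      = ENNReal.ofReal (hh A x) := by
  induction n with
  | zero => simp [hit]
  | succ n ih =>
    rw [Finset.sum_range_succ, add_assoc, ← ih]
    congr 1
    have h1 := lintegral_hit W A hd x n 0
    have h2 := lintegral_hit W A hd x n 1
    rw [add_zero] at h1
    rw [← h1, ← h2, ← lintegral_add_left]
    · refine lintegral_congr fun ω => ?_
      have hp := Pop_hh A hd (W.Y n ω)
      have hp0 := Pop_nonneg (hh_nonneg A hd) (W.Y n ω)
      simp only [hit]
      rw [← ENNReal.ofReal_add (ee_nonneg A _) hp0, hp]
      congr 1; ring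
    · exact ENNReal.measurable_ofReal.comp ((measurable_of_countable (ee A)).comp (W.measurable_Y n))

lemma ae_summable (hd : 3 ≤ d) (x : Zd d) :
    ∀ᵐ ω ∂W.P x, Summable fun k => ee A (W.Y k ω) * W.ζ k ω := by
  have := W.isProb x
  have hm : ∀ k, Measurable fun ω => ENNReal.ofReal (ee A (W.Y k ω) * W.ζ k ω) := fun k =>
    ENNReal.measurable_ofReal.comp
      (((measurable_of_countable (ee A)).comp (W.measurable_Y k)).mul (W.measurable_ζ k))
  have h1 : ∀ k, ∫⁻ ω, ENNReal.ofReal (ee A (W.Y k ω) * W.ζ k ω) ∂W.P x =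
      ∫⁻ ω, ENNReal.ofReal (ee A (W.Y k ω)) ∂W.P x := by
    intro k
    have h := markov_single W hd x k (fun y t => ENNReal.ofReal (ee A y * t)) (fun y => by fun_prop)
      (fun _ => 1) (fun _ => zero_le_one)
    simp only [ENNReal.ofReal_one, mul_one, Pop_const hd, lintegral_exp_id _ (ee_nonneg A _)] at h
    exact h
  have h2 : ∫⁻ ω, ∑' k, ENNReal.ofReal (ee A (W.Y k ω) * W.ζ k ω) ∂W.P x ≠ ⊤ := by
    rw [lintegral_tsum fun k => (hm k).aemeasurable]
    simp_rw [h1]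
    refine ne_top_of_le_ne_top (b := ENNReal.ofReal (hh A x)) ENNReal.ofReal_ne_top ?_
    rw [ENNReal.tsum_eq_iSup_nat]
    refine iSup_le fun n => ?_
    rw [← lintegral_ee W A hd x n]
    exact le_self_add
  have h3 := ae_lt_top' (Measurable.tsum hm).aemeasurable h2
  filter_upwards [h3, ae_good W hd x] with ω hω hg
  have := ENNReal.summable_toReal hω.ne
  refine this.congr fun k => ?_
  rw [ENNReal.toReal_ofReal (mul_nonneg (ee_nonneg A _) (hg.1 k).le)]

lemma lintegral_mart (hd : 3 ≤ d) (x : Zd d) (l : ℝ) (hl : 0 ≤ l) (n : ℕ) :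
    ∫⁻ ω, (∏ k ∈ Finset.range n, ENNReal.ofReal (Real.exp (-((l * ee A (W.Y k ω)) * W.ζ k ω)))) *
      ENNReal.ofReal (1 - l / (1 + l) * hh A (W.Y n ω)) ∂W.P x =
      ENNReal.ofReal (1 - l / (1 + l) * hh A x) := by
  have := W.isProb x
  have hk : l / (1 + l) ≤ 1 := by rw [div_le_one (by linarith)]; linarith
  have hk0 : 0 ≤ l / (1 + l) := by positivity
  have hw : ∀ y, 0 ≤ 1 - l / (1 + l) * hh A y := by
    intro y
    have := mul_le_one₀ hk (hh_nonneg A hd y) (hh_le_one A y)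
    linarith
  induction n with
  | zero =>
    have : ∫⁻ ω, ENNReal.ofReal (1 - l / (1 + l) * hh A (W.Y 0 ω)) ∂W.P x =
        ∫⁻ ω, ENNReal.ofReal (1 - l / (1 + l) * hh A x) ∂W.P x := by
      refine lintegral_congr_ae ?_
      filter_upwards [ae_Y_zero W x] with ω hω
      rw [hω]
    simp only [Finset.range_zero, Finset.prod_empty, one_mul]
    rw [this]; simp
  | succ n ih =>
    have h := markov W hd x n (fun k y t => ENNReal.ofReal (Real.exp (-((l * ee A y) * t))))
      (fun k y => by fun_prop) (fun y => 1 - l / (1 + l) * hh A y) hw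
    rw [h, ← ih]
    refine lintegral_congr fun ω => ?_
    congr 1
    set y := W.Y n ω
    have he := ee_nonneg A y
    rw [lintegral_exp_laplace _ (mul_nonneg hl he), ← ENNReal.ofReal_mul (by positivity)]
    congr 1
    rw [Pop_sub (fun _ => 1) (fun y => l / (1 + l) * hh A y), Pop_const hd, Pop_smul, Pop_hh A hd]
    have h1 : 1 + l ≠ 0 := by positivity
    have h2 : 1 + l * ee A y ≠ 0 := by positivity
    by_cases hy : y ∈ A
    · rw [hh_of_mem A hd y hy]
      field_simp
      ring
    · have : ee A y = 0 := by simp [ee, hy]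
      rw [this]; simp

lemma lintegral_V (hd : 3 ≤ d) (hA : A.Finite) (x : Zd d) (l : ℝ) (hl : 0 ≤ l) :
    ∫⁻ ω, ENNReal.ofReal (Real.exp (-(l * ∑' k, ee A (W.Y k ω) * W.ζ k ω))) ∂W.P x =
      ENNReal.ofReal (1 - l / (1 + l) * hh A x) := by
  have := W.isProb x
  have hk : l / (1 + l) ≤ 1 := by rw [div_le_one (by linarith)]; linarith
  have hk0 : 0 ≤ l / (1 + l) := by positivity
  have hw : ∀ y, 0 ≤ 1 - l / (1 + l) * hh A y := by
    intro y
    have := mul_le_one₀ hk (hh_nonneg A hd y) (hh_le_one A y)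
    linarith
  let M : ℕ → Ω → ℝ≥0∞ := fun n ω =>
    ∏ k ∈ Finset.range n, ENNReal.ofReal (Real.exp (-((l * ee A (W.Y k ω)) * W.ζ k ω)))
  have hMm : ∀ n, Measurable (M n) := by
    intro n
    refine Finset.measurable_prod _ fun k _ => ?_
    have h1 := (measurable_of_countable (ee A)).comp (W.measurable_Y k)
    have h2 := W.measurable_ζ k
    exact ENNReal.measurable_ofReal.comp (Real.measurable_exp.comp (((h1.const_mul l).mul h2).neg))
  have hMexp : ∀ n ω, M n ω = ENNReal.ofReal (Real.exp (-(l * ∑ k ∈ Finset.range n, ee A (W.Y k ω) * W.ζ k ω))) := by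
    intro n ω
    simp only [M]
    rw [← ENNReal.ofReal_prod_of_nonneg (fun _ _ => Real.exp_nonneg _), ← Real.exp_sum,
      Finset.sum_neg_distrib, Finset.mul_sum]
    simp_rw [mul_assoc]
  have hM1 : ∀ n, ∀ᵐ ω ∂W.P x, M n ω ≤ 1 := by
    intro n
    filter_upwards [ae_good W hd x] with ω hω
    rw [hMexp, ENNReal.ofReal_le_one, Real.exp_le_one_iff]
    have : 0 ≤ ∑ k ∈ Finset.range n, ee A (W.Y k ω) * W.ζ k ω :=
      Finset.sum_nonneg fun k _ => mul_nonneg (ee_nonneg A _) (hω.1 k).le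
    have := mul_nonneg hl this
    linarith
  have lim1 : Filter.Tendsto (fun n => ∫⁻ ω, M n ω ∂W.P x) Filter.atTop
      (nhds (∫⁻ ω, ENNReal.ofReal (Real.exp (-(l * ∑' k, ee A (W.Y k ω) * W.ζ k ω))) ∂W.P x)) := by
    refine tendsto_lintegral_of_dominated_convergence (fun _ => 1) hMm hM1 (by simp) ?_
    filter_upwards [ae_summable W A hd x] with ω hω
    simp_rw [hMexp]
    refine (ENNReal.continuous_ofReal.tendsto _).comp ((Real.continuous_exp.tendsto _).comp ?_)
    exact (hω.hasSum.tendsto_sum_nat.const_mul l).neg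
  have lim2 : Filter.Tendsto (fun n => ∫⁻ ω, M n ω ∂W.P x) Filter.atTop
      (nhds (ENNReal.ofReal (1 - l / (1 + l) * hh A x))) := by
    have hup : Filter.Tendsto (fun n => ENNReal.ofReal (1 - l / (1 + l) * hh A x) +
        ENNReal.ofReal (hit A n x)) Filter.atTop (nhds (ENNReal.ofReal (1 - l / (1 + l) * hh A x))) := by
      have h0 := (ENNReal.continuous_ofReal.tendsto _).comp (hit_tendsto A hd hA x)
      rw [ENNReal.ofReal_zero] at h0
      simpa using h0.const_add (ENNReal.ofReal (1 - l / (1 + l) * hh A x))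
    refine tendsto_of_tendsto_of_tendsto_of_le_of_le tendsto_const_nhds hup ?_ ?_
    · intro n
      simp only
      rw [← lintegral_mart W A hd x l hl n]
      refine lintegral_mono fun ω => ?_
      refine mul_le_of_le_one_right (zero_le) ?_
      rw [ENNReal.ofReal_le_one]
      have := mul_nonneg hk0 (hh_nonneg A hd (W.Y n ω))
      linarith
    · intro n
      simp only
      have h1 := lintegral_hit W A hd x n 0
      rw [add_zero] at h1
      rw [← lintegral_mart W A hd x l hl n, ← h1, ← lintegral_add_right]
      · refine lintegral_mono_ae ?_
        filter_upwards [hM1 n] with ω hω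
        have e : (1 : ℝ≥0∞) ≤ ENNReal.ofReal (1 - l / (1 + l) * hh A (W.Y n ω)) +
            ENNReal.ofReal (hh A (W.Y n ω)) := by
          rw [← ENNReal.ofReal_add (hw _) (hh_nonneg A hd _), ENNReal.one_le_ofReal]
          have := mul_le_mul_of_nonneg_right hk (hh_nonneg A hd (W.Y n ω))
          linarith
        calc M n ω = M n ω * 1 := (mul_one _).symm
          _ ≤ M n ω * (ENNReal.ofReal (1 - l / (1 + l) * hh A (W.Y n ω)) +
            ENNReal.ofReal (hh A (W.Y n ω))) := by gcongr
          _ = M n ω * ENNReal.ofReal (1 - l / (1 + l) * hh A (W.Y n ω)) +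
            M n ω * ENNReal.ofReal (hh A (W.Y n ω)) := mul_add _ _ _
          _ ≤ _ := by
            refine add_le_add le_rfl ?_
            exact mul_le_of_le_one_left (zero_le) hω
      · exact ENNReal.measurable_ofReal.comp ((measurable_of_countable _).comp (W.measurable_Y n))
  exact tendsto_nhds_unique lim1 lim2

lemma measurable_V : Measurable fun ω => ∑' k, ee A (W.Y k ω) * W.ζ k ω := by
  have hm : ∀ k, Measurable fun ω => ee A (W.Y k ω) * W.ζ k ω := fun k =>
      (((measurable_of_countable (ee A)).comp (W.measurable_Y k)).mul (W.measurable_ζ k))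
  exact Measurable.tsum hm

lemma ae_V (hd : 3 ≤ d) (x : Zd d) :
    (fun ω => ∫ s in Set.Ioi (0 : ℝ), W.eqm A (W.X s ω)) =ᵐ[W.P x]
      fun ω => ∑' k, ee A (W.Y k ω) * W.ζ k ω := by
  filter_upwards [ae_good W hd x, ae_summable W A hd x] with ω h1 h2
  simp_rw [eqm_eq W hd]
  exact h1.integral _ (ee_nonneg A) h2

lemma map_V (hd : 3 ≤ d) (hA : A.Finite) (x : Zd d) (hx : x ∈ A) :
    (W.P x).map (fun ω => ∑' k, ee A (W.Y k ω) * W.ζ k ω) = expMeasure := by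
  have := W.isProb x
  have hV := measurable_V W A
  have := Measure.isProbabilityMeasure_map (μ := W.P x) hV.aemeasurable
  refine laplace_ext _ _ ?_ ?_ fun n => ?_
  · rw [ae_map_iff hV.aemeasurable measurableSet_Ici]
    filter_upwards [ae_good W hd x] with ω hω
    exact tsum_nonneg fun k => mul_nonneg (ee_nonneg A _) (hω.1 k).le
  · have : expMeasure {x | ¬ 0 < x} = 0 := expMeasure_Ioi
    have h2 : ∀ᵐ x ∂expMeasure, 0 < x := this
    exact h2.mono fun x hx => hx.le
  · rw [lintegral_exp_laplace _ n.cast_nonneg, lintegral_map (by fun_prop) hV,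
      lintegral_V W A hd hA x n n.cast_nonneg, hh_of_mem A hd x hx]
    congr 1
    have : (1 : ℝ) + n ≠ 0 := by positivity
    field_simp
    ring

lemma cap_eq (hd : 3 ≤ d) (hA : A.Finite) : W.cap A = ∑ x ∈ hA.toFinset, ee A x := by
  unfold SRW.cap
  simp_rw [eqm_eq W hd]
  refine finsum_eq_sum_of_support_subset _ ?_
  intro x hx
  by_contra h
  simp at h
  exact hx (by simp [ee, h])

end Aux
end Disconnection

open Disconnection

/-- under `P_{ē_A}`, `∫₀^∞ e_A(X_s) ds` is exponential of parameter 1. -/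
theorem statement0 {d : ℕ} (hd : 3 ≤ d) {Ω : Type*} [MeasurableSpace Ω] (W : SRW d Ω)
    (A : Set (Zd d)) (hfin : A.Finite) (hne : A.Nonempty) :
    Measure.map (fun ω => ∫ s in Set.Ioi (0 : ℝ), W.eqm A (W.X s ω))
        (W.Pinit (W.ebar A)) = expMeasure := by
  have hae : (fun ω => ∫ s in Set.Ioi (0 : ℝ), W.eqm A (W.X s ω)) =ᵐ[W.Pinit (W.ebar A)]
      fun ω => ∑' k, Aux.ee A (W.Y k ω) * W.ζ k ω := by
    unfold SRW.Pinit
    refine Measure.ae_sum_iff.2 fun x => ?_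
    exact Measure.ae_smul_measure (Aux.ae_V W A hd x) _
  rw [Measure.map_congr hae]
  have hV := Aux.measurable_V W A
  have hcap := Aux.cap_eq W A hd hfin
  have hcpos : 0 < W.cap A := by
    rw [hcap]
    obtain ⟨x, hx, hpos⟩ := Aux.exists_ee_pos A hd hfin hne
    exact Finset.sum_pos' (fun y _ => Aux.ee_nonneg A y) ⟨x, hfin.mem_toFinset.2 hx, hpos⟩
  ext s hs
  unfold SRW.Pinit
  rw [Measure.map_apply hV hs, Measure.sum_apply _ (hV hs)]
  have hterm : ∀ x, (ENNReal.ofReal (W.ebar A x) • W.P x)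
      ((fun ω => ∑' k, Aux.ee A (W.Y k ω) * W.ζ k ω) ⁻¹' s) =
      ENNReal.ofReal (Aux.ee A x / W.cap A) * expMeasure s := by
    intro x
    rw [Measure.smul_apply, smul_eq_mul, SRW.ebar, Aux.eqm_eq W hd]
    by_cases hx : x ∈ A
    · rw [← Aux.map_V W A hd hfin x hx, Measure.map_apply hV hs]
    · simp [Aux.ee, hx]
  simp_rw [hterm]
  rw [ENNReal.tsum_mul_right, tsum_eq_sum (s := hfin.toFinset),
    ← ENNReal.ofReal_sum_of_nonneg, ← Finset.sum_div, ← hcap, div_self hcpos.ne']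
  · simp
  · intro x _
    exact div_nonneg (Aux.ee_nonneg A x) hcpos.le
  · intro x hx
    have : x ∉ A := by simpa using hx
    simp [Aux.ee, this]
end

section
/- Let A be a finite nonempty subset of ℤ^d (d ≥ 3). Then for every integer n ≥ 0, E_{ē_A}[(∫₀^∞ e_A(X_s) ds)^n] = n!. -/
open MeasureTheory ENNReal Set
open scoped Classical NNReal

open Disconnection

/-! abstract potential theory -/
section Abs
variable {d : ℕ}

noncomputable def Pop (ν : Measure (Zd d)) (f : Zd d → ℝ≥0∞) (x : Zd d) : ℝ≥0∞ :=
  ∫⁻ v, f (x + v) ∂ν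

lemma Pop_mono (ν : Measure (Zd d)) {f g : Zd d → ℝ≥0∞} (h : f ≤ g) : Pop ν f ≤ Pop ν g :=
  fun _ => lintegral_mono fun _ => h _

lemma Pop_iter_mono (ν : Measure (Zd d)) (N : ℕ) {f g : Zd d → ℝ≥0∞} (h : f ≤ g) :
    (Pop ν)^[N] f ≤ (Pop ν)^[N] g := by
  induction N generalizing f g with
  | zero => exact h
  | succ N ih => exact ih (Pop_mono ν h)

lemma Pop_add (ν : Measure (Zd d)) (f g : Zd d → ℝ≥0∞) : Pop ν (f + g) = Pop ν f + Pop ν g := by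
  funext x
  exact lintegral_add_left (Measurable.of_discrete) _

lemma Pop_iter_add (ν : Measure (Zd d)) (N : ℕ) (f g : Zd d → ℝ≥0∞) :
    (Pop ν)^[N] (f + g) = (Pop ν)^[N] f + (Pop ν)^[N] g := by
  induction N generalizing f g with
  | zero => rfl
  | succ N ih => simp only [Function.iterate_succ_apply, Pop_add, ih]

lemma Pop_const_mul (ν : Measure (Zd d)) (c : ℝ≥0∞) (f : Zd d → ℝ≥0∞) :
    Pop ν (fun x => c * f x) = fun x => c * Pop ν f x := by
  funext x
  exact lintegral_const_mul _ (Measurable.of_discrete)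

lemma Pop_iter_const_mul (ν : Measure (Zd d)) (N : ℕ) (c : ℝ≥0∞) (f : Zd d → ℝ≥0∞) :
    (Pop ν)^[N] (fun x => c * f x) = fun x => c * (Pop ν)^[N] f x := by
  induction N generalizing f with
  | zero => rfl
  | succ N ih => simp only [Function.iterate_succ_apply, Pop_const_mul, ih]

lemma Pop_iter_tsum (ν : Measure (Zd d)) (N : ℕ) (f : ℕ → Zd d → ℝ≥0∞) :
    (Pop ν)^[N] (fun x => ∑' k, f k x) = fun x => ∑' k, (Pop ν)^[N] (f k) x := by
  induction N generalizing f with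
  | zero => rfl
  | succ N ih =>
    have : Pop ν (fun x => ∑' k, f k x) = fun x => ∑' k, Pop ν (f k) x := by
      funext x
      exact lintegral_tsum (fun _ => Measurable.of_discrete.aemeasurable)
    simp only [Function.iterate_succ_apply, this]
    exact ih _

lemma Pop_iter_zero (ν : Measure (Zd d)) (N : ℕ) : (Pop ν)^[N] (fun _ => 0) = fun _ => 0 := by
  induction N with
  | zero => rfl
  | succ N ih =>
    have : Pop ν (fun _ => 0) = fun _ => 0 := by funext x; simp [Pop]
    rw [Function.iterate_succ_apply, this, ih]

lemma telescoping (ν : Measure (Zd d)) (e g : Zd d → ℝ≥0∞) (h : e + Pop ν g = g) (N : ℕ)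
    (x : Zd d) : ∑ k ∈ Finset.range N, (Pop ν)^[k] e x + (Pop ν)^[N] g x = g x := by
  induction N with
  | zero => simp
  | succ N ih =>
    have h2 : (Pop ν)^[N] g = (Pop ν)^[N] e + (Pop ν)^[N+1] g := by
      rw [Function.iterate_succ_apply, ← Pop_iter_add, h]
    rw [h2] at ih
    rw [Finset.sum_range_succ, add_assoc]
    exact ih

/-- Transience from a strictly superharmonic function. -/
lemma green_finite (ν : Measure (Zd d)) (f : Zd d → ℝ≥0∞) (hf : ∀ x, f x ≠ ⊤)
    (hs : ∀ x, Pop ν f x < f x) (A : Set (Zd d)) (hA : A.Finite) (x : Zd d) :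
    ∑' k, (Pop ν)^[k] (A.indicator 1) x ≠ ⊤ := by
  set δ : Zd d → ℝ≥0∞ := fun x => f x - Pop ν f x with hδ
  have hδf : δ + Pop ν f = f := by
    funext x
    exact tsub_add_cancel_of_le (hs x).le
  have hG : ∑' k, (Pop ν)^[k] δ x ≤ f x := by
    rw [ENNReal.tsum_eq_iSup_nat]
    refine iSup_le fun N => ?_
    rw [← telescoping ν δ f hδf N x]
    exact le_self_add
  set C : ℝ≥0∞ := ∑ y ∈ hA.toFinset, (δ y)⁻¹ with hC
  have hCt : C ≠ ⊤ := by
    rw [hC]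
    refine (ENNReal.sum_ne_top).2 fun y _ => ?_
    rw [Ne, ENNReal.inv_eq_top]
    exact (tsub_pos_of_lt (hs y)).ne'
  have hle : (A.indicator 1 : Zd d → ℝ≥0∞) ≤ fun y => C * δ y := by
    intro y
    by_cases hy : y ∈ A
    · rw [Set.indicator_of_mem hy]
      have h0 : δ y ≠ 0 := (tsub_pos_of_lt (hs y)).ne'
      have h1 : δ y ≠ ⊤ := ne_top_of_le_ne_top (hf y) tsub_le_self
      calc (1 : ℝ≥0∞) = (δ y)⁻¹ * δ y := (ENNReal.inv_mul_cancel h0 h1).symm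
        _ ≤ C * δ y := by
          gcongr
          exact Finset.single_le_sum (f := fun y => (δ y)⁻¹) (fun _ _ => zero_le)
            (hA.mem_toFinset.2 hy)
    · rw [Set.indicator_of_notMem hy]; exact zero_le
  have h3 : ∑' k, (Pop ν)^[k] (A.indicator 1) x ≤ C * f x := by
    calc _ ≤ ∑' k, C * (Pop ν)^[k] δ x := by
          refine ENNReal.tsum_le_tsum fun k => ?_
          have := Pop_iter_mono ν k hle x
          rwa [Pop_iter_const_mul] at this
      _ = C * ∑' k, (Pop ν)^[k] δ x := ENNReal.tsum_mul_left
      _ ≤ _ := by gcongr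
  exact ne_top_of_le_ne_top (ENNReal.mul_ne_top hCt (hf x)) h3

/-- hitting probabilities among the first `N` points -/
noncomputable def hitP (ν : Measure (Zd d)) (A : Set (Zd d)) : ℕ → Zd d → ℝ≥0∞
  | 0 => fun _ => 0
  | N + 1 => fun x => if x ∈ A then 1 else Pop ν (hitP ν A N) x

lemma hitP_mono (ν : Measure (Zd d)) (A : Set (Zd d)) : Monotone (hitP ν A) := by
  refine monotone_nat_of_le_succ fun N => ?_
  induction N with
  | zero => intro x; exact zero_le
  | succ N ih =>
    intro x
    simp only [hitP]
    split_ifs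
    · exact le_rfl
    · exact Pop_mono ν ih x

lemma hitP_le_one (ν : Measure (Zd d)) [IsProbabilityMeasure ν] (A : Set (Zd d)) (N : ℕ)
    (x : Zd d) : hitP ν A N x ≤ 1 := by
  induction N generalizing x with
  | zero => exact zero_le
  | succ N ih =>
    simp only [hitP]
    split_ifs
    · exact le_rfl
    · calc Pop ν (hitP ν A N) x ≤ ∫⁻ _, 1 ∂ν := lintegral_mono fun _ => ih _
        _ = 1 := by simp

noncomputable def hitI (ν : Measure (Zd d)) (A : Set (Zd d)) (x : Zd d) : ℝ≥0∞ :=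
  ⨆ N, hitP ν A N x

lemma Pop_hitI (ν : Measure (Zd d)) (A : Set (Zd d)) (x : Zd d) :
    Pop ν (hitI ν A) x = ⨆ N, Pop ν (hitP ν A N) x := by
  exact lintegral_iSup (fun _ => Measurable.of_discrete) (fun i j h v => hitP_mono ν A h _)

lemma Pop_hitI_le_one (ν : Measure (Zd d)) [IsProbabilityMeasure ν] (A : Set (Zd d))
    (x : Zd d) : Pop ν (hitI ν A) x ≤ 1 := by
  calc Pop ν (hitI ν A) x ≤ ∫⁻ _, 1 ∂ν :=
        lintegral_mono fun _ => iSup_le fun N => hitP_le_one ν A N _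
    _ = 1 := by simp

lemma hitI_eq (ν : Measure (Zd d)) (A : Set (Zd d)) (x : Zd d) :
    hitI ν A x = if x ∈ A then 1 else Pop ν (hitI ν A) x := by
  have h : hitI ν A x = ⨆ N, hitP ν A (N+1) x := by
    have hm : Monotone fun N => hitP ν A N x := fun i j h => hitP_mono ν A h x
    exact (hm.iSup_nat_add 1).symm
  rw [h, Pop_hitI]
  simp only [hitP]
  split_ifs <;> simp

lemma hitP_le_green (ν : Measure (Zd d)) (A : Set (Zd d)) (N : ℕ) :
    hitP ν A N ≤ fun x => ∑ k ∈ Finset.range N, (Pop ν)^[k] (A.indicator 1) x := by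
  induction N with
  | zero => intro x; exact zero_le
  | succ N ih =>
    intro x
    have hP : Pop ν (hitP ν A N) x ≤ ∑ k ∈ Finset.range N, (Pop ν)^[k+1] (A.indicator 1) x := by
      refine (Pop_mono ν ih x).trans ?_
      simp only [Function.iterate_succ_apply']
      simp only [Pop]
      rw [lintegral_finsetSum _ (fun _ _ => Measurable.of_discrete)]
    simp only [hitP]
    rw [Finset.sum_range_succ']
    split_ifs with h
    · simp [h]
    · exact hP.trans le_self_add

/-- the equilibrium potential is the potential of the equilibrium measure -/
lemma green_eq (ν : Measure (Zd d)) (A : Set (Zd d)) (e : Zd d → ℝ≥0∞)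
    (he : e + Pop ν (hitI ν A) = hitI ν A)
    (hG : ∀ x, ∑' k, (Pop ν)^[k] (A.indicator 1) x ≠ ⊤) (x : Zd d) :
    ∑' k, (Pop ν)^[k] e x = hitI ν A x := by
  have hle : hitI ν A ≤ fun x => ∑' k, (Pop ν)^[k] (A.indicator 1) x := fun x =>
    iSup_le fun N => (hitP_le_green ν A N x).trans (ENNReal.sum_le_tsum _)
  have hz : Filter.Tendsto (fun N => (Pop ν)^[N] (hitI ν A) x) Filter.atTop (nhds 0) := by
    refine tendsto_of_tendsto_of_tendsto_of_le_of_le tendsto_const_nhds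
      (ENNReal.tendsto_sum_nat_add (fun k => (Pop ν)^[k] (A.indicator 1) x) (hG x))
      (fun _ => zero_le) (fun N => ?_)
    have := Pop_iter_mono ν N hle x
    rw [Pop_iter_tsum] at this
    refine this.trans (le_of_eq ?_)
    refine tsum_congr fun k => ?_
    rw [← Function.iterate_add_apply, add_comm]
  have h1 := (ENNReal.tendsto_nat_tsum (fun k => (Pop ν)^[k] e x)).add hz
  have h2 : (fun N => ∑ k ∈ Finset.range N, (Pop ν)^[k] e x + (Pop ν)^[N] (hitI ν A) x)
      = fun _ => hitI ν A x := by
    funext N; exact telescoping ν e _ he N x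
  rw [h2, add_zero] at h1
  exact tendsto_nhds_unique h1 tendsto_const_nhds |>.symm ▸ rfl

/-- Kac moment recursion. -/
lemma moments (ν : Measure (Zd d)) [IsProbabilityMeasure ν] (A : Set (Zd d))
    (e : Zd d → ℝ≥0∞) (he0 : ∀ x, x ∉ A → e x = 0)
    (he : e + Pop ν (hitI ν A) = hitI ν A)
    (hG : ∀ x, ∑' k, (Pop ν)^[k] (A.indicator 1) x ≠ ⊤)
    (M : ℕ → ℕ → Zd d → ℝ≥0∞)
    (hM0 : ∀ N x, M N 0 x = 1) (hM1 : ∀ n x, M 0 (n+1) x = 0)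
    (hMs : ∀ N n x, M (N+1) (n+1) x = (n+1 : ℕ) * e x * M (N+1) n x + Pop ν (M N (n+1)) x)
    (hmono : ∀ n x, Monotone fun N => M N n x) (n : ℕ) (x : Zd d) (hx : x ∈ A) :
    ⨆ N, M N n x = (n.factorial : ℝ≥0∞) := by
  have gA : ∀ x ∈ A, hitI ν A x = 1 := fun x hx => by rw [hitI_eq, if_pos hx]
  have up : ∀ n N x, M N (n+1) x ≤ ((n+1).factorial : ℝ≥0∞) * hitI ν A x := by
    intro n
    induction n with
    | zero =>
      intro N
      induction N with
      | zero => intro x; rw [hM1]; exact zero_le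
      | succ N ih =>
        intro x
        rw [hMs, hM0]
        have h2 := Pop_mono ν (show M N (0+1) ≤ fun x => _ from ih) x
        rw [Pop_const_mul] at h2
        have h3 := congrFun he x
        simp only [Pi.add_apply] at h3
        rw [← h3, mul_add]
        simp at h2 ⊢
        gcongr
    | succ n ihn =>
      intro N
      induction N with
      | zero => intro x; rw [hM1]; exact zero_le
      | succ N ih =>
        intro x
        rw [hMs]
        have h2 := Pop_mono ν (show M N (n+1+1) ≤ fun x => _ from ih) x
        rw [Pop_const_mul] at h2
        have h3 := congrFun he x
        simp only [Pi.add_apply] at h3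
        rw [← h3, mul_add]
        refine add_le_add ?_ h2
        by_cases hxA : x ∈ A
        · have h4 := ihn (N+1) x
          rw [gA x hxA, mul_one] at h4
          calc _ ≤ ((n+1+1 : ℕ) : ℝ≥0∞) * e x * ((n+1).factorial : ℝ≥0∞) := by gcongr
            _ = _ := by rw [Nat.factorial_succ (n+1)]; push_cast; ring
        · simp [he0 x hxA]
  have rec1 : ∀ n x, ⨆ N, M N (n+1) x
      = (n+1 : ℕ) * e x * (⨆ N, M N n x) + Pop ν (fun y => ⨆ N, M N (n+1) y) x := by
    intro n x
    rw [← (hmono (n+1) x).iSup_nat_add 1, ← (hmono n x).iSup_nat_add 1]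
    simp only [hMs]
    have hP : Pop ν (fun y => ⨆ N, M N (n+1) y) x = ⨆ N, Pop ν (M N (n+1)) x :=
      lintegral_iSup (fun _ => Measurable.of_discrete) (fun i j h v => hmono _ _ h)
    rw [hP, ENNReal.mul_iSup, ENNReal.iSup_add_iSup_of_monotone]
    · intro i j h
      have := hmono n x (Nat.add_le_add_right h 1)
      dsimp only at this ⊢
      gcongr
    · intro i j h
      exact Pop_mono ν (fun y => hmono (n+1) y h) x
  induction n generalizing x with
  | zero => simp [hM0]
  | succ n ih =>
    refine le_antisymm ?_ ?_
    · refine iSup_le fun N => ?_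
      have := up n N x
      rwa [gA x hx, mul_one] at this
    · have h5 : (fun y => ((n+1).factorial : ℝ≥0∞) * e y) + Pop ν (fun y => ⨆ N, M N (n+1) y)
          = fun y => ⨆ N, M N (n+1) y := by
        funext y
        rw [rec1 n y, Pi.add_apply]
        congr 1
        by_cases hy : y ∈ A
        · rw [ih y hy, Nat.factorial_succ]; push_cast; ring
        · simp [he0 y hy]
      have h6 : ∑' k, (Pop ν)^[k] (fun y => ((n+1).factorial : ℝ≥0∞) * e y) x
          ≤ ⨆ N, M N (n+1) x := by
        rw [ENNReal.tsum_eq_iSup_nat]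
        refine iSup_le fun K => ?_
        rw [← telescoping ν _ _ h5 K x]
        exact le_self_add
      simp only [Pop_iter_const_mul] at h6
      rw [ENNReal.tsum_mul_left, green_eq ν A e he hG x, gA x hx, mul_one] at h6
      exact h6

end Abs

section Trans
variable {d : ℕ}

lemma rpow_q (y : ℝ) (hy : 0 < y) : (y ^ (-(1/4) : ℝ)) ^ 4 * y = 1 := by
  rw [← Real.rpow_natCast, ← Real.rpow_mul hy.le]
  norm_num
  rw [Real.rpow_neg_one, inv_mul_cancel₀ hy.ne']

lemma rpow_le_q (y q : ℝ) (hy : 0 < y) (hq : 0 ≤ q) (h : 1 ≤ q ^ 4 * y) :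
    y ^ (-(1/4) : ℝ) ≤ q := by
  have h1 := rpow_q y hy
  have h2 : (y ^ (-(1/4) : ℝ)) ^ 4 ≤ q ^ 4 := by
    rw [← h1] at h
    exact le_of_mul_le_mul_right h hy
  exact le_of_pow_le_pow_left₀ (by norm_num) hq h2

lemma q_le_rpow (y q : ℝ) (hy : 0 < y) (h : q ^ 4 * y ≤ 1) :
    q ≤ y ^ (-(1/4) : ℝ) := by
  have h1 := rpow_q y hy
  have h2 : q ^ 4 ≤ (y ^ (-(1/4) : ℝ)) ^ 4 := by
    rw [← h1] at h
    exact le_of_mul_le_mul_right h hy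
  exact le_of_pow_le_pow_left₀ (by norm_num) (by positivity) h2

lemma taylor_up (u : ℝ) (h1 : -(1/30) ≤ u) (h2 : u ≤ 1/30) :
    (1 + u) ^ (-(1/4) : ℝ) ≤ 1 - u/4 + 3/16 * u^2 := by
  have hu2 : 0 ≤ u^2 := sq_nonneg u
  have h3 : u^3 ≤ u^2/30 := by nlinarith
  have h3' : -(u^2/30) ≤ u^3 := by nlinarith
  apply rpow_le_q _ _ (by linarith) (by nlinarith)
  have hw : 1 - u/2 + 434/1000*u^2 ≤ (1 - u/4 + 3/16 * u^2)^2 := by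
    have : (1 - u/4 + 3/16 * u^2)^2 = 1 - u/2 + 7/16*u^2 - 3/32 * u^3 + 9/256*(u^2)^2 := by ring
    rw [this]
    nlinarith [sq_nonneg (u^2)]
  have hw0 : 0 ≤ 1 - u/2 + 434/1000*u^2 := by nlinarith
  have hw2 : 1 - u + 11/10 * u^2 ≤ (1 - u/2 + 434/1000*u^2)^2 := by
    have : (1 - u/2 + 434/1000*u^2)^2 = 1 - u + 1118/1000*u^2 - 434/1000*u^3
      + (434/1000)^2*(u^2)^2 := by ring
    rw [this]
    nlinarith [sq_nonneg (u^2)]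
  have hw4 : 1 - u + 11/10 * u^2 ≤ (1 - u/4 + 3/16 * u^2)^4 := by
    calc _ ≤ _ := hw2
      _ ≤ ((1 - u/4 + 3/16 * u^2)^2)^2 := by gcongr
      _ = _ := by ring
  calc (1:ℝ) ≤ (1 - u + 11/10 * u^2) * (1 + u) := by nlinarith
    _ ≤ _ := by
      apply mul_le_mul_of_nonneg_right hw4; linarith

lemma taylor_lo (s : ℝ) (h1 : 0 ≤ s) (h2 : s < 1) :
    1 + s/4 ≤ (1 - s) ^ (-(1/4) : ℝ) := by
  apply q_le_rpow _ _ (by linarith)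
  have h3 : (1 + s/4)^4 * (1 - s) = 1 - s^2 * (10/16 + 5/16*s+ 15/256*s^2 + s^3/256) := by ring
  rw [h3]
  have : 0 ≤ s^2 * (10/16 + 5/16*s+ 15/256*s^2 + s^3/256) := by positivity
  linarith

noncomputable def sq2 (x : Zd d) : ℝ := ∑ i, ((x i : ℝ))^2

noncomputable def lyap (x : Zd d) : ℝ := (1000 + sq2 x) ^ (-(1/4) : ℝ)

lemma sq2_nonneg (x : Zd d) : 0 ≤ sq2 x := Finset.sum_nonneg fun _ _ => sq_nonneg _

lemma sq2_add_single (x : Zd d) (i : Fin d) (σ : ℤ) (hσ : σ^2 = 1) :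
    sq2 (x + Pi.single i σ) = sq2 x + 1 + 2 * σ * x i := by
  have hσ' : (σ:ℝ)^2 = 1 := by exact_mod_cast hσ
  have h : sq2 (x + Pi.single i σ) - sq2 x = 1 + 2 * σ * x i := by
    unfold sq2
    rw [← Finset.sum_sub_distrib]
    rw [Finset.sum_eq_single i]
    · simp; linear_combination hσ'
    · intro b _ hb; simp [hb]
    · simp
  linarith

lemma lyap_pair (x : Zd d) (i : Fin d) :
    lyap (x + Pi.single i 1) + lyap (x + Pi.single i (-1)) ≤
      (1001 + sq2 x) ^ (-(1/4) : ℝ) * (2 + 3/2 * (x i : ℝ)^2 / (1001 + sq2 x)^2) := by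
  set R := 1001 + sq2 x with hR
  have hR0 : 0 < R := by have := sq2_nonneg x; linarith
  have hxi : (x i : ℝ)^2 ≤ sq2 x :=
    Finset.single_le_sum (f := fun i => (x i : ℝ)^2) (fun _ _ => sq_nonneg _) (Finset.mem_univ i)
  set u := 2 * (x i : ℝ) / R with hu
  have hu1 : u ≤ 1/30 := by
    rw [hu, div_le_iff₀ hR0]; nlinarith [sq_nonneg ((x i : ℝ) - 30)]
  have hu2 : -(1/30) ≤ u := by
    rw [hu, le_div_iff₀ hR0]; nlinarith [sq_nonneg ((x i : ℝ) + 30)]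
  have e1 : lyap (x + Pi.single i 1) = R ^ (-(1/4) : ℝ) * (1 + u) ^ (-(1/4) : ℝ) := by
    rw [← Real.mul_rpow hR0.le (by linarith), lyap, sq2_add_single x i 1 (by norm_num)]
    congr 1
    rw [hu]; field_simp; push_cast; linarith
  have e2 : lyap (x + Pi.single i (-1)) = R ^ (-(1/4) : ℝ) * (1 + -u) ^ (-(1/4) : ℝ) := by
    rw [← Real.mul_rpow hR0.le (by linarith), lyap, sq2_add_single x i (-1) (by norm_num)]
    congr 1
    rw [hu]; field_simp; push_cast; linarith
  rw [e1, e2, ← mul_add]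
  apply mul_le_mul_of_nonneg_left _ (by positivity)
  have t1 := taylor_up u hu2 hu1
  have t2 := taylor_up (-u) (by linarith) (by linarith)
  have : 3/2 * (x i : ℝ)^2 / R^2 = 3/8 * u^2 := by rw [hu]; field_simp; ring
  rw [this]
  nlinarith

lemma lyap_super (hd : 3 ≤ d) (x : Zd d) :
    ∑ i : Fin d, (2 * (d:ℝ))⁻¹ * (lyap (x + Pi.single i 1) + lyap (x + Pi.single i (-1)))
      < lyap x := by
  set R := 1001 + sq2 x with hR
  have hs := sq2_nonneg x
  have hR0 : 0 < R := by linarith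
  have hd' : (3:ℝ) ≤ d := by exact_mod_cast hd
  have hd0 : (0:ℝ) < d := by linarith
  have hRp : 0 < R ^ (-(1/4) : ℝ) := by positivity
  calc _ ≤ ∑ i : Fin d, (2 * (d:ℝ))⁻¹ * (R ^ (-(1/4) : ℝ) * (2 + 3/2 * (x i : ℝ)^2 / R^2)) := by
        gcongr with i _
        exact lyap_pair x i
    _ = R ^ (-(1/4) : ℝ) * (1 + 3/4 * sq2 x / (d * R^2)) := by
        rw [← Finset.mul_sum, ← Finset.mul_sum, Finset.sum_add_distrib, ← Finset.sum_div,
          ← Finset.mul_sum]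
        simp only [Finset.sum_const, Finset.card_univ, Fintype.card_fin, nsmul_eq_mul]
        change _ * (_ * (_ + 3/2 * sq2 x / R^2)) = _
        field_simp
        ring
    _ < R ^ (-(1/4) : ℝ) * (1 + (1/R)/4) := by
        apply mul_lt_mul_of_pos_left _ hRp
        have : 3/4 * sq2 x / (d * R^2) < 1/R/4 := by
          rw [div_div, div_lt_div_iff₀ (by positivity) (by positivity)]
          have h3 : 3 * sq2 x < d * R := by nlinarith
          nlinarith
        linarith
    _ ≤ R ^ (-(1/4) : ℝ) * (1 - 1/R) ^ (-(1/4) : ℝ) := by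
        apply mul_le_mul_of_nonneg_left _ hRp.le
        apply taylor_lo _ (by positivity)
        rw [div_lt_one hR0]; linarith
    _ = lyap x := by
        rw [← Real.mul_rpow hR0.le]
        · rw [lyap]; congr 1; field_simp; linarith
        · rw [sub_nonneg, div_le_one hR0]; linarith

lemma unit_vec (v : Zd d) (h : (∑ i, (v i).natAbs) = 1) :
    ∃ i, v = Pi.single i 1 ∨ v = Pi.single i (-1) := by
  have hex : ∃ i, v i ≠ 0 := by
    by_contra! hc
    simp [hc] at h
  obtain ⟨i, hi⟩ := hex
  refine ⟨i, ?_⟩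
  have h1 : (v i).natAbs + ∑ j ∈ Finset.univ.erase i, (v j).natAbs = 1 := by
    rw [Finset.add_sum_erase _ (fun j => (v j).natAbs) (Finset.mem_univ i)]; exact h
  have h2 : 1 ≤ (v i).natAbs := by omega
  have h3 : ∑ j ∈ Finset.univ.erase i, (v j).natAbs = 0 := by omega
  have h4 : (v i).natAbs = 1 := by omega
  have h5 : ∀ j, j ≠ i → v j = 0 := by
    intro j hj
    have := (Finset.sum_eq_zero_iff.1 h3) j (by simp [hj])
    omega
  have h6 : v i = 1 ∨ v i = -1 := by omega
  rcases h6 with h6 | h6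
  · left; funext j
    by_cases hj : j = i
    · subst hj; simp [h6]
    · simp [hj, h5 j hj]
  · right; funext j
    by_cases hj : j = i
    · subst hj; simp [h6]
    · simp [hj, h5 j hj]

lemma Pop_le (ν : Measure (Zd d)) (hν : ∀ v, ν {v} = stepP d v) (f : Zd d → ℝ≥0∞) (x : Zd d) :
    Pop ν f x ≤ ∑ i : Fin d, ((2 * d : ℕ) : ℝ≥0∞)⁻¹ *
      (f (x + Pi.single i 1) + f (x + Pi.single i (-1))) := by
  set c := ((2 * d : ℕ) : ℝ≥0∞)⁻¹ with hc
  unfold Pop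
  rw [lintegral_countable']
  calc _ ≤ ∑' v, ∑ i : Fin d, ((if v = Pi.single i 1 then c * f (x + v) else 0)
            + (if v = Pi.single i (-1) then c * f (x + v) else 0)) := by
        refine ENNReal.tsum_le_tsum fun v => ?_
        rw [hν, stepP]
        split_ifs with h
        · obtain ⟨i, hi⟩ := unit_vec v h
          refine le_trans ?_ (Finset.single_le_sum (fun _ _ => zero_le) (Finset.mem_univ i))
          rcases hi with hi | hi
          · rw [if_pos hi, mul_comm]; exact le_self_add
          · rw [if_pos hi, mul_comm]; exact le_add_self
        · simp
    _ = _ := by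
        rw [Summable.tsum_finsetSum (fun _ _ => ENNReal.summable)]
        refine Finset.sum_congr rfl fun i _ => ?_
        rw [ENNReal.tsum_add, tsum_eq_single (Pi.single i 1), tsum_eq_single (Pi.single i (-1))]
        · simp [mul_add]
        · intro b hb; simp [hb]
        · intro b hb; simp [hb]

lemma transience (hd : 3 ≤ d) (ν : Measure (Zd d)) (hν : ∀ v, ν {v} = stepP d v)
    (A : Set (Zd d)) (hA : A.Finite) (x : Zd d) :
    ∑' k, (Pop ν)^[k] (A.indicator 1) x ≠ ⊤ := by
  have hpos : ∀ y : Zd d, 0 < lyap y := fun y => by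
    have := sq2_nonneg y
    unfold lyap; positivity
  refine green_finite ν (fun y => ENNReal.ofReal (lyap y)) (fun _ => ENNReal.ofReal_ne_top)
    (fun y => ?_) A hA x
  refine (Pop_le ν hν _ y).trans_lt ?_
  have h : ∑ i : Fin d, ((2 * d : ℕ) : ℝ≥0∞)⁻¹ *
      (ENNReal.ofReal (lyap (y + Pi.single i 1)) + ENNReal.ofReal (lyap (y + Pi.single i (-1))))
      = ENNReal.ofReal (∑ i : Fin d, (2 * (d:ℝ))⁻¹ *
        (lyap (y + Pi.single i 1) + lyap (y + Pi.single i (-1)))) := by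
    have hc : ((2 * d : ℕ) : ℝ≥0∞)⁻¹ = ENNReal.ofReal ((2 * (d:ℝ))⁻¹) := by
      rw [ENNReal.ofReal_inv_of_pos (by positivity)]
      congr 1
      rw [← ENNReal.ofReal_natCast]; push_cast; rfl
    rw [ENNReal.ofReal_sum_of_nonneg]
    · refine Finset.sum_congr rfl fun i _ => ?_
      rw [ENNReal.ofReal_mul (by positivity), ENNReal.ofReal_add (hpos _).le (hpos _).le, hc]
    · intro i _
      have h1 := hpos (y + Pi.single i 1)
      have h2 := hpos (y + Pi.single i (-1))
      positivity
  rw [h]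
  exact (ENNReal.ofReal_lt_ofReal_iff (hpos y)).2 (lyap_super hd y)

end Trans

section Expo

lemma meas_expd : Measurable fun t : ℝ => ENNReal.ofReal (if 0 < t then Real.exp (-t) else 0) := by
  apply Measurable.ennreal_ofReal
  exact Measurable.ite measurableSet_Ioi (by fun_prop) measurable_const

lemma lintegral_expM (f : ℝ → ℝ≥0∞) (hf : Measurable f) :
    ∫⁻ t, f t ∂Disconnection.expMeasure = ∫⁻ t in Ioi 0, ENNReal.ofReal (Real.exp (-t)) * f t := by
  rw [Disconnection.expMeasure, lintegral_withDensity_eq_lintegral_mul _ meas_expd hf,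
    ← lintegral_indicator measurableSet_Ioi]
  congr 1
  funext t
  by_cases h : 0 < t <;> simp [h, Set.indicator]

lemma tz (α l : ℝ) (n : ℕ) :
    Filter.Tendsto (fun t : ℝ => (α * t + l)^n * Real.exp (-(t/2))) Filter.atTop (nhds 0) := by
  have h := (Polynomial.tendsto_div_exp_atTop
    ((Polynomial.C (2*α) * Polynomial.X + Polynomial.C l)^n)).comp
    (Filter.tendsto_id.atTop_div_const (show (0:ℝ) < 2 by norm_num))
  refine h.congr fun t => ?_
  simp only [Function.comp, Polynomial.eval_pow, Polynomial.eval_add, Polynomial.eval_mul,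
    Polynomial.eval_C, Polynomial.eval_X, id, Real.exp_neg, div_eq_mul_inv]
  congr 2
  ring

lemma exp_half (t : ℝ) : Real.exp (-t) = Real.exp (-(t/2)) * Real.exp (-(1/2) * t) := by
  rw [← Real.exp_add]; congr 1; ring

lemma intg (α l : ℝ) (n : ℕ) :
    IntegrableOn (fun t : ℝ => (α * t + l)^n * Real.exp (-t)) (Ioi 0) := by
  refine integrable_of_isBigO_exp_neg (b := 1/2) (by norm_num) (by fun_prop) ?_
  have h := ((tz α l n).isBigO_one ℝ).mul
    (Asymptotics.isBigO_refl (fun t : ℝ => Real.exp (-(1/2) * t)) Filter.atTop)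
  simp only [one_mul] at h
  refine h.congr_left fun t => ?_
  rw [exp_half t]; ring

lemma tz' (α l : ℝ) (n : ℕ) :
    Filter.Tendsto (fun t : ℝ => (α * t + l)^n * Real.exp (-t)) Filter.atTop (nhds 0) := by
  have h2 : Filter.Tendsto (fun t : ℝ => Real.exp (-(1/2) * t)) Filter.atTop (nhds 0) := by
    refine Real.tendsto_exp_atBot.comp ?_
    exact Filter.tendsto_id.const_mul_atTop_of_neg (by norm_num)
  have h := (tz α l n).mul h2
  rw [zero_mul] at h
  refine h.congr fun t => ?_
  rw [exp_half t]; ring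

lemma ibp_real (α l : ℝ) (n : ℕ) :
    ∫ t in Ioi (0:ℝ), (α * t + l)^(n+1) * Real.exp (-t)
      = l^(n+1) + (n+1 : ℕ) * α * ∫ t in Ioi (0:ℝ), (α * t + l)^n * Real.exp (-t) := by
  have h := integral_Ioi_of_hasDerivAt_of_tendsto (a := (0:ℝ))
    (f := fun t : ℝ => -((α * t + l)^(n+1) * Real.exp (-t)))
    (f' := fun t => (α * t + l)^(n+1) * Real.exp (-t)
      - ((n+1 : ℕ) * α) * ((α * t + l)^n * Real.exp (-t))) (m := 0)
    (by fun_prop) ?_ ((intg α l (n+1)).sub ((intg α l n).const_mul _))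
    (by simpa using (tz' α l (n+1)).neg)
  · rw [integral_sub (intg α l (n+1)) ((intg α l n).const_mul _), integral_const_mul] at h
    simp at h
    push_cast
    linarith
  · intro t _
    have h1 : HasDerivAt (fun t : ℝ => α * t + l) α t := by
      simpa using ((hasDerivAt_id t).const_mul α).add_const l
    have h2 := (h1.pow (n+1)).mul ((hasDerivAt_neg t).exp)
    have h3 : HasDerivAt (fun t : ℝ => -((α * t + l)^(n+1) * Real.exp (-t))) _ t := h2.neg
    refine h3.congr_deriv ?_
    simp only [Pi.pow_apply, Nat.add_sub_cancel]
    ring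

lemma lint_real (a l : ℝ) (ha : 0 ≤ a) (hl : 0 ≤ l) (n : ℕ) :
    ∫⁻ t, (ENNReal.ofReal a * ENNReal.ofReal t + ENNReal.ofReal l)^n ∂Disconnection.expMeasure
      = ENNReal.ofReal (∫ t in Ioi (0:ℝ), (a * t + l)^n * Real.exp (-t)) := by
  rw [lintegral_expM _ (by fun_prop), ofReal_integral_eq_lintegral_ofReal (intg a l n)]
  · refine setLIntegral_congr_fun measurableSet_Ioi fun t ht => ?_
    have ht' : 0 ≤ t := le_of_lt ht
    rw [← ENNReal.ofReal_mul ha, ← ENNReal.ofReal_add (by positivity) hl,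
      ← ENNReal.ofReal_pow (by positivity), ← ENNReal.ofReal_mul (by positivity), mul_comm]
  · refine (ae_restrict_iff' measurableSet_Ioi).2 (ae_of_all _ fun t ht => ?_)
    have ht' : 0 ≤ t := le_of_lt ht
    simp only [Pi.zero_apply]
    positivity

instance expM_prob : IsProbabilityMeasure Disconnection.expMeasure := by
  constructor
  have h := lint_real 0 0 le_rfl le_rfl 0
  simp only [pow_zero, lintegral_const, one_mul] at h
  rw [h, integral_exp_neg_Ioi_zero, ENNReal.ofReal_one]

lemma ibp (a l : ℝ≥0∞) (ha : a ≠ ⊤) (n : ℕ) :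
    ∫⁻ t, (a * ENNReal.ofReal t + l)^(n+1) ∂Disconnection.expMeasure
      = l^(n+1) + (n+1 : ℕ) * a * ∫⁻ t, (a * ENNReal.ofReal t + l)^n ∂Disconnection.expMeasure := by
  by_cases hl : l = ⊤
  · subst hl; simp
  have h1 : a = ENNReal.ofReal a.toReal := (ENNReal.ofReal_toReal ha).symm
  have h2 : l = ENNReal.ofReal l.toReal := (ENNReal.ofReal_toReal hl).symm
  generalize a.toReal = α at h1
  generalize hll : l.toReal = m at h2
  have ha0 : ENNReal.ofReal α = ENNReal.ofReal (max α 0) := by simp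
  have hm0 : ENNReal.ofReal m = ENNReal.ofReal (max m 0) := by simp
  rw [ha0] at h1
  rw [hm0] at h2
  have hα : 0 ≤ max α 0 := le_max_right _ _
  have hm : 0 ≤ max m 0 := le_max_right _ _
  generalize max α 0 = α at *
  generalize max m 0 = m at *
  subst h1 h2
  rw [lint_real _ _ hα hm, lint_real _ _ hα hm, ibp_real]
  have hJ : 0 ≤ ∫ t in Ioi (0:ℝ), (α * t + m)^n * Real.exp (-t) := by
    refine setIntegral_nonneg measurableSet_Ioi fun t ht => ?_
    have ht' : 0 ≤ t := le_of_lt ht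
    positivity
  rw [ENNReal.ofReal_add (by positivity) (by positivity), ENNReal.ofReal_pow hm,
    ENNReal.ofReal_mul (by positivity), ENNReal.ofReal_mul (by positivity), ENNReal.ofReal_natCast]

lemma expM_Iic : Disconnection.expMeasure (Iic 0) = 0 := by
  rw [Disconnection.expMeasure, withDensity_apply _ measurableSet_Iic]
  rw [setLIntegral_congr_fun measurableSet_Iic (g := fun _ => 0)]
  · simp
  · intro t ht
    have : ¬ (0 < t) := not_lt.2 ht
    simp [this]

lemma expM_Iio_lt : Disconnection.expMeasure (Iio 1) < 1 := by
  refine lt_of_le_of_ne prob_le_one fun h => ?_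
  have h1 : Disconnection.expMeasure (Iio 1)ᶜ = 0 := by
    rw [prob_compl_eq_zero_iff measurableSet_Iio]; exact h
  rw [Disconnection.expMeasure, withDensity_apply_eq_zero meas_expd] at h1
  have h2 : ({x : ℝ | ENNReal.ofReal (if 0 < x then Real.exp (-x) else 0) ≠ 0} ∩ (Iio 1)ᶜ)
      = Ici 1 := by
    ext t
    simp only [mem_inter_iff, mem_ofPred_eq, mem_compl_iff, mem_Iio, not_lt, mem_Ici]
    refine ⟨fun h => h.2, fun h => ⟨?_, h⟩⟩
    have : 0 < t := by linarith
    simp [this, Real.exp_pos]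
  rw [h2] at h1
  simp at h1

end Expo

section Law
variable {d : ℕ} {Ω : Type*} [MeasurableSpace Ω] (W : SRW d Ω)

noncomputable def stepM : Measure (Zd d) := (W.P 0).map fun ω => W.Y 1 ω - W.Y 0 ω

instance stepM_prob : IsProbabilityMeasure (stepM W) := by
  have := W.isProb 0
  exact Measure.isProbabilityMeasure_map ((W.measurable_Y 1).sub (W.measurable_Y 0)).aemeasurable

lemma stepM_single (v : Zd d) : stepM W {v} = stepP d v := by
  have h := W.law 0 1 (fun _ => v) (fun _ => univ) (fun _ => MeasurableSet.univ)
  have hm : Measurable fun ω => W.Y 1 ω - W.Y 0 ω := (W.measurable_Y 1).sub (W.measurable_Y 0)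
  rw [stepM, Measure.map_apply hm (measurableSet_singleton v)]
  simp at h
  exact h

noncomputable def etaM : Measure (Zd d × ℝ) := (stepM W).prod Disconnection.expMeasure

instance etaM_prob : IsProbabilityMeasure (etaM W) := by unfold etaM; infer_instance

def eta (j N : ℕ) (ω : Ω) : Fin N → Zd d × ℝ :=
  fun i => (W.Y (j + i + 1) ω - W.Y (j + i) ω, W.ζ (j + i) ω)

lemma measurable_eta (j N : ℕ) : Measurable (eta W j N) := by
  refine measurable_pi_lambda _ fun i => ?_
  exact ((W.measurable_Y _).sub (W.measurable_Y _)).prodMk (W.measurable_ζ _)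

lemma eta_tail (j N : ℕ) (ω : Ω) : Fin.tail (eta W j (N+1) ω) = eta W (j+1) N ω := by
  funext i
  simp only [Fin.tail, eta, Fin.val_succ]
  rw [show j + (↑i + 1) = j + 1 + ↑i by ring]

def singC (d : ℕ) : Set (Set (Zd d)) := {s | ∃ v, s = {v}}

lemma singC_gen : MeasurableSpace.generateFrom (singC d) = (inferInstance : MeasurableSpace (Zd d)) := by
  refine le_antisymm ?_ ?_
  · refine MeasurableSpace.generateFrom_le ?_
    rintro s ⟨v, rfl⟩
    exact measurableSet_singleton v
  · intro s _
    rw [← Set.biUnion_of_singleton s]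
    refine MeasurableSet.biUnion s.to_countable fun v _ => ?_
    exact MeasurableSpace.measurableSet_generateFrom ⟨v, rfl⟩

lemma singC_pi : IsPiSystem (singC d) := by
  rintro s ⟨v, rfl⟩ t ⟨w, rfl⟩ ⟨z, hz⟩
  refine ⟨v, ?_⟩
  have h1 : z = v := hz.1
  have h2 : z = w := hz.2
  subst h1 h2
  simp

noncomputable def singC_span (ν : Measure (Zd d)) [IsFiniteMeasure ν] : ν.FiniteSpanningSetsIn (singC d) where
  set n := {(exists_surjective_nat (Zd d)).choose n}
  set_mem n := ⟨_, rfl⟩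
  finite n := measure_lt_top _ _
  spanning := by
    ext v
    obtain ⟨n, hn⟩ := (exists_surjective_nat (Zd d)).choose_spec v
    simp only [mem_iUnion, mem_singleton_iff, mem_univ, iff_true]
    exact ⟨n, hn.symm⟩

lemma law_pi (x : Zd d) (N : ℕ) :
    (W.P x).map (eta W 0 N) = Measure.pi (fun _ : Fin N => etaM W) := by
  symm
  refine Measure.pi_eq_generateFrom
    (C := fun _ => image2 (fun a b => a ×ˢ b) (singC d) {s : Set ℝ | MeasurableSet s})
    (fun _ => generateFrom_eq_prod singC_gen MeasurableSpace.generateFrom_measurableSet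
      (singC_span (stepM W)).isCountablySpanning isCountablySpanning_measurableSet)
    (fun _ => singC_pi.prod MeasurableSpace.isPiSystem_measurableSet)
    (fun _ => (singC_span (stepM W)).prod (Measure.toFiniteSpanningSetsIn _)) ?_
  intro s hs
  choose a ha b hb hab using hs
  choose v hv using ha
  have hm : MeasurableSet (univ.pi s) := by
    refine MeasurableSet.univ_pi fun i => ?_
    rw [← hab i, hv i]
    exact (measurableSet_singleton _).prod (hb i)
  rw [Measure.map_apply (measurable_eta W 0 N) hm]
  have hL := W.law x N v b hb
  rw [← Finset.prod_mul_distrib] at hL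
  have e : eta W 0 N ⁻¹' univ.pi s = {ω | (∀ i : Fin N, W.Y ((i : ℕ) + 1) ω - W.Y (i : ℕ) ω = v i) ∧
             (∀ i : Fin N, W.ζ (i : ℕ) ω ∈ b i)} := by
    ext ω
    simp only [mem_preimage, mem_univ_pi, mem_ofPred_eq, ← forall_and]
    refine forall_congr' fun i => ?_
    rw [← hab i, hv i]
    simp [eta]
  rw [e, hL]
  refine Finset.prod_congr rfl fun i _ => ?_
  rw [← hab i, hv i, ← stepM_single W]
  exact (Measure.prod_prod _ _).symm

lemma lint_eta (x : Zd d) (N : ℕ) (F : (Fin N → Zd d × ℝ) → ℝ≥0∞) (hF : Measurable F) :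
    ∫⁻ ω, F (eta W 0 N ω) ∂(W.P x) = ∫⁻ h, F h ∂(Measure.pi (fun _ : Fin N => etaM W)) := by
  rw [← law_pi W x N, lintegral_map hF (measurable_eta W 0 N)]

/-- first step decomposition of the product measure -/
lemma lint_succ (N : ℕ) (F : (Fin (N+1) → Zd d × ℝ) → ℝ≥0∞) (hF : Measurable F) :
    ∫⁻ h, F h ∂(Measure.pi (fun _ : Fin (N+1) => etaM W))
      = ∫⁻ v, ∫⁻ h, ∫⁻ t, F (Fin.cons (v, t) h) ∂Disconnection.expMeasure
        ∂(Measure.pi (fun _ : Fin N => etaM W)) ∂(stepM W) := by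
  have hp := (measurePreserving_piFinSuccAbove (fun _ : Fin (N+1) => etaM W) 0).symm
  rw [← hp.lintegral_comp hF]
  have hm : Measurable fun a : (Zd d × ℝ) × (Fin N → Zd d × ℝ) =>
      F ((MeasurableEquiv.piFinSuccAbove (fun _ : Fin (N+1) => Zd d × ℝ) 0).symm a) :=
    hF.comp (MeasurableEquiv.measurable _)
  rw [lintegral_prod _ hm.aemeasurable]
  unfold etaM
  rw [lintegral_prod _ (Measurable.lintegral_prod_right' hm).aemeasurable]
  refine lintegral_congr fun v => ?_
  rw [lintegral_lintegral_swap]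
  · refine lintegral_congr fun h => lintegral_congr fun t => ?_
    congr 1
    simp [MeasurableEquiv.piFinSuccAbove, Fin.insertNthEquiv]
  · refine Measurable.aemeasurable ?_
    exact hm.comp (by fun_prop)

end Law

section Fun
variable {d : ℕ}

noncomputable def Tf (e : Zd d → ℝ≥0∞) : (N : ℕ) → (Fin N → Zd d × ℝ) → Zd d → ℝ≥0∞
  | 0, _, _ => 0
  | N + 1, h, x => e x * ENNReal.ofReal (h 0).2 + Tf e N (Fin.tail h) (x + (h 0).1)

noncomputable def Hf (A : Set (Zd d)) : (N : ℕ) → (Fin N → Zd d × ℝ) → Zd d → ℝ≥0∞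
  | 0, _, _ => 0
  | N + 1, h, x => if x ∈ A then 1 else Hf A N (Fin.tail h) (x + (h 0).1)

lemma meas_tail (N : ℕ) : Measurable (fun p : (Fin (N+1) → Zd d × ℝ) × Zd d =>
    ((Fin.tail p.1, p.2 + (p.1 0).1) : (Fin N → Zd d × ℝ) × Zd d)) := by
  refine Measurable.prodMk ?_ ?_
  · refine measurable_pi_lambda _ fun i => ?_
    exact (measurable_pi_apply i.succ).comp measurable_fst
  · exact measurable_snd.add (measurable_fst.comp ((measurable_pi_apply 0).comp measurable_fst))

lemma meas_Tf (e : Zd d → ℝ≥0∞) (N : ℕ) :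
    Measurable (fun p : (Fin N → Zd d × ℝ) × Zd d => Tf e N p.1 p.2) := by
  induction N with
  | zero => exact measurable_const
  | succ N ih =>
    have h1 : Measurable (fun p : (Fin (N+1) → Zd d × ℝ) × Zd d => e p.2) :=
      (Measurable.of_discrete (f := e)).comp measurable_snd
    have h2 : Measurable (fun p : (Fin (N+1) → Zd d × ℝ) × Zd d => ENNReal.ofReal (p.1 0).2) :=
      ENNReal.measurable_ofReal.comp
        (measurable_snd.comp ((measurable_pi_apply 0).comp measurable_fst))
    exact (h1.mul h2).add (ih.comp (meas_tail N))

lemma meas_Hf (A : Set (Zd d)) (N : ℕ) :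
    Measurable (fun p : (Fin N → Zd d × ℝ) × Zd d => Hf A N p.1 p.2) := by
  induction N with
  | zero => exact measurable_const
  | succ N ih =>
    refine Measurable.ite ?_ measurable_const (ih.comp (meas_tail N))
    exact measurable_snd (MeasurableSet.of_discrete (s := A))

lemma meas_Tf' (e : Zd d → ℝ≥0∞) (N : ℕ) (x : Zd d) : Measurable (fun h => Tf e N h x) :=
  (meas_Tf e N).comp (measurable_id.prodMk measurable_const)

lemma meas_Hf' (A : Set (Zd d)) (N : ℕ) (x : Zd d) : Measurable (fun h => Hf A N h x) :=
  (meas_Hf A N).comp (measurable_id.prodMk measurable_const)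

variable {Ω : Type*} [MeasurableSpace Ω] (W : SRW d Ω)

noncomputable def Mom (e : Zd d → ℝ≥0∞) (N n : ℕ) (x : Zd d) : ℝ≥0∞ :=
  ∫⁻ h, (Tf e N h x)^n ∂(Measure.pi (fun _ : Fin N => etaM W))

lemma Mom_succ (e : Zd d → ℝ≥0∞) (he : ∀ x, e x ≠ ⊤) (N n : ℕ) (x : Zd d) :
    Mom W e (N+1) (n+1) x
      = (n+1 : ℕ) * e x * Mom W e (N+1) n x + Pop (stepM W) (Mom W e N (n+1)) x := by
  unfold Mom Pop
  rw [lint_succ W N _ ((meas_Tf' e (N+1) x).pow_const _),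
    lint_succ W N _ ((meas_Tf' e (N+1) x).pow_const _)]
  have hT : ∀ v t (h : Fin N → Zd d × ℝ), Tf e (N+1) (Fin.cons (v,t) h) x
      = e x * ENNReal.ofReal t + Tf e N h (x + v) := fun v t h => rfl
  simp only [hT]
  have hm : ∀ v, Measurable fun h : Fin N → Zd d × ℝ =>
      ∫⁻ t, (e x * ENNReal.ofReal t + Tf e N h (x + v))^n ∂Disconnection.expMeasure := by
    intro v
    refine Measurable.lintegral_prod_right'
      (f := fun p : (Fin N → Zd d × ℝ) × ℝ => (e x * ENNReal.ofReal p.2 + Tf e N p.1 (x + v))^n) ?_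
    refine Measurable.pow_const (Measurable.add (by fun_prop) ?_) _
    exact (meas_Tf' e N (x+v)).comp measurable_fst
  rw [← lintegral_const_mul _ Measurable.of_discrete, ← lintegral_add_left Measurable.of_discrete]
  refine lintegral_congr fun v => ?_
  rw [← lintegral_const_mul _ (hm v), ← lintegral_add_left ((hm v).const_mul _)]
  refine lintegral_congr fun h => ?_
  rw [ibp _ _ (he x), add_comm]

lemma int_Hf_shift (A : Set (Zd d)) (N : ℕ) (x : Zd d)
    (ih : ∀ x, ∫⁻ h, Hf A N h x ∂(Measure.pi (fun _ : Fin N => etaM W)) = hitP (stepM W) A N x) :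
    ∫⁻ h, Hf A N (Fin.tail h) (x + (h 0).1) ∂(Measure.pi (fun _ : Fin (N+1) => etaM W))
      = Pop (stepM W) (hitP (stepM W) A N) x := by
  rw [lint_succ W N]
  · unfold Pop
    refine lintegral_congr fun v => ?_
    rw [← ih]
    refine lintegral_congr fun h => ?_
    have : ∀ t : ℝ, Hf A N (Fin.tail (Fin.cons (v,t) h : Fin (N+1) → Zd d × ℝ))
      (x + ((Fin.cons (v,t) h : Fin (N+1) → Zd d × ℝ) 0).1) = Hf A N h (x+v) := fun t => rfl
    simp only [this]
    simp
  · exact ((meas_Hf A N).comp (meas_tail N)).comp (measurable_id.prodMk measurable_const)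

lemma int_Hf (A : Set (Zd d)) (N : ℕ) (x : Zd d) :
    ∫⁻ h, Hf A N h x ∂(Measure.pi (fun _ : Fin N => etaM W)) = hitP (stepM W) A N x := by
  induction N generalizing x with
  | zero => simp [Hf, hitP]
  | succ N ih =>
    simp only [Hf, hitP]
    split_ifs with h
    · simp
    · exact int_Hf_shift W A N x ih

lemma Tf_eta (e : Zd d → ℝ≥0∞) (N j : ℕ) (ω : Ω) :
    Tf e N (eta W j N ω) (W.Y j ω)
      = ∑ k ∈ Finset.range N, e (W.Y (j + k) ω) * ENNReal.ofReal (W.ζ (j + k) ω) := by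
  induction N generalizing j with
  | zero => simp [Tf]
  | succ N ih =>
    rw [Finset.sum_range_succ']
    simp only [Tf]
    rw [eta_tail]
    have : W.Y j ω + (eta W j (N+1) ω 0).1 = W.Y (j+1) ω := by simp [eta]
    rw [this, ih (j+1), add_comm]
    simp only [show ∀ k, j + 1 + k = j + (k + 1) from fun k => by ring]
    simp [eta]

lemma Hf_eta (A : Set (Zd d)) (N j : ℕ) (ω : Ω) :
    Hf A N (eta W j N ω) (W.Y j ω) = if ∃ k < N, W.Y (j + k) ω ∈ A then 1 else 0 := by
  induction N generalizing j with
  | zero => simp [Hf]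
  | succ N ih =>
    simp only [Hf]
    rw [eta_tail]
    have : W.Y j ω + (eta W j (N+1) ω 0).1 = W.Y (j+1) ω := by simp [eta]
    rw [this, ih (j+1)]
    split_ifs with h1 h2 h3 h4 h5
    · rfl
    · exact absurd ⟨0, by omega, by simpa using h1⟩ h2
    · rfl
    · obtain ⟨k, hk, hk'⟩ := h3
      exact absurd ⟨k+1, by omega, by rwa [show j + (k+1) = j + 1 + k by ring]⟩ h4
    · obtain ⟨k, hk, hk'⟩ := h5
      rcases k with _ | k
      · exact absurd (by simpa using hk') h1
      · exact absurd ⟨k, by omega, by rwa [show j + 1 + k = j + (k+1) by ring]⟩ h3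
    · rfl

lemma Y0_ae (x : Zd d) : ∀ᵐ ω ∂(W.P x), W.Y 0 ω = x := by
  have := W.isProb x
  have h := W.Y_zero x
  rw [← prob_compl_eq_zero_iff] at h
  · exact h
  · exact W.measurable_Y 0 (measurableSet_singleton x)

lemma meas_exY (A : Set (Zd d)) (N : ℕ) : MeasurableSet {ω | ∃ k < N, W.Y (1 + k) ω ∈ A} := by
  have : {ω | ∃ k < N, W.Y (1 + k) ω ∈ A} = ⋃ k, ⋃ _ : k < N, W.Y (1+k) ⁻¹' A := by
    ext ω; simp
  rw [this]
  exact MeasurableSet.iUnion fun k => MeasurableSet.iUnion fun _ =>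
    W.measurable_Y _ MeasurableSet.of_discrete

lemma prob_ret (A : Set (Zd d)) (x : Zd d) :
    W.P x {ω | ∃ k, W.Y (1 + k) ω ∈ A} = Pop (stepM W) (hitI (stepM W) A) x := by
  have hU : {ω | ∃ k, W.Y (1 + k) ω ∈ A} = ⋃ N, {ω | ∃ k < N, W.Y (1 + k) ω ∈ A} := by
    ext ω
    simp only [mem_ofPred_eq, mem_iUnion]
    exact ⟨fun ⟨k, hk⟩ => ⟨k+1, k, by omega, hk⟩, fun ⟨N, k, _, hk⟩ => ⟨k, hk⟩⟩
  have hmono : Monotone fun N => {ω | ∃ k < N, W.Y (1 + k) ω ∈ A} := by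
    intro i j hij ω ⟨k, hk, hk'⟩
    exact ⟨k, lt_of_lt_of_le hk hij, hk'⟩
  rw [hU, hmono.measure_iUnion, Pop_hitI]
  congr 1
  funext N
  rw [← lintegral_indicator_one (meas_exY W A N), ← int_Hf_shift W A N x (int_Hf W A N),
    ← lint_eta W x (N+1)
      (fun h => Hf A N (Fin.tail h) (x + (h 0).1))
      (((meas_Hf A N).comp (meas_tail N)).comp (measurable_id.prodMk measurable_const))]
  refine lintegral_congr_ae ?_
  filter_upwards [Y0_ae W x] with ω hω
  rw [eta_tail]
  have : x + (eta W 0 (N+1) ω 0).1 = W.Y 1 ω := by simp [eta, hω]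
  rw [this, zero_add, Hf_eta]
  simp [Set.indicator]

/-- truncated total time -/
noncomputable def TN (e : Zd d → ℝ≥0∞) (N : ℕ) (ω : Ω) : ℝ≥0∞ :=
  ∑ k ∈ Finset.range N, e (W.Y k ω) * ENNReal.ofReal (W.ζ k ω)

noncomputable def TI (e : Zd d → ℝ≥0∞) (ω : Ω) : ℝ≥0∞ :=
  ∑' k, e (W.Y k ω) * ENNReal.ofReal (W.ζ k ω)

lemma meas_TN (e : Zd d → ℝ≥0∞) (N : ℕ) : Measurable (TN W e N) :=
  Finset.measurable_fun_sum _ fun k _ => ((Measurable.of_discrete (f := e)).comp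
    (W.measurable_Y k)).mul (ENNReal.measurable_ofReal.comp (W.measurable_ζ k))

lemma meas_TI (e : Zd d → ℝ≥0∞) : Measurable (TI W e) :=
  Measurable.tsum fun k => ((Measurable.of_discrete (f := e)).comp
    (W.measurable_Y k)).mul (ENNReal.measurable_ofReal.comp (W.measurable_ζ k))

lemma TN_mono (e : Zd d → ℝ≥0∞) (ω : Ω) : Monotone fun N => TN W e N ω := by
  intro i j hij
  exact Finset.sum_le_sum_of_subset (Finset.range_mono hij)

lemma Mom_eq (e : Zd d → ℝ≥0∞) (N n : ℕ) (x : Zd d) :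
    Mom W e N n x = ∫⁻ ω, (TN W e N ω)^n ∂(W.P x) := by
  rw [Mom, ← lint_eta W x N _ ((meas_Tf' e N x).pow_const n)]
  refine lintegral_congr_ae ?_
  filter_upwards [Y0_ae W x] with ω hω
  have := Tf_eta W e N 0 ω
  rw [hω] at this
  rw [this, TN]
  simp

lemma TI_pow (e : Zd d → ℝ≥0∞) (n : ℕ) (x : Zd d) :
    ∫⁻ ω, (TI W e ω)^n ∂(W.P x) = ⨆ N, Mom W e N n x := by
  simp only [Mom_eq]
  rw [← lintegral_iSup (fun N => (meas_TN W e N).pow_const n)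
    (fun i j h ω => pow_le_pow_left' (TN_mono W e ω h) n)]
  refine lintegral_congr fun ω => ?_
  have h1 := tendsto_atTop_iSup (TN_mono W e ω)
  have h2 : ⨆ N, TN W e N ω = TI W e ω := ENNReal.tsum_eq_iSup_nat.symm
  rw [h2] at h1
  have h3 := ((ENNReal.continuous_pow n).tendsto _).comp h1
  have h4 := tendsto_atTop_iSup
    (show Monotone fun N => TN W e N ω ^ n from fun i j h => pow_le_pow_left' (TN_mono W e ω h) n)
  exact tendsto_nhds_unique h3 h4

lemma TI_moment (A : Set (Zd d)) (e : Zd d → ℝ≥0∞) (he : ∀ x, e x ≠ ⊤)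
    (he0 : ∀ x, x ∉ A → e x = 0)
    (heq : e + Pop (stepM W) (hitI (stepM W) A) = hitI (stepM W) A)
    (hG : ∀ x, ∑' k, (Pop (stepM W))^[k] (A.indicator 1) x ≠ ⊤)
    (n : ℕ) (x : Zd d) (hx : x ∈ A) :
    ∫⁻ ω, (TI W e ω)^n ∂(W.P x) = (n.factorial : ℝ≥0∞) := by
  rw [TI_pow]
  refine moments (stepM W) A e he0 heq hG (Mom W e) ?_ ?_ (Mom_succ W e he) ?_ n x hx
  · intro N x; simp [Mom]
  · intro n x; simp [Mom, Tf]
  · intro n x i j h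
    simp only [Mom_eq]
    exact lintegral_mono fun ω => pow_le_pow_left' (TN_mono W e ω h) n

end Fun

section Path
variable {d : ℕ} {Ω : Type*} [MeasurableSpace Ω] (W : SRW d Ω)

def Good (ω : Ω) : Prop := (∀ k, 0 < W.ζ k ω) ∧ ∀ m, ∃ k ≥ m, 1 ≤ W.ζ k ω

lemma zeta_law (x : Zd d) (N : ℕ) (I : Fin N → Set ℝ) (hI : ∀ i, MeasurableSet (I i)) :
    W.P x {ω | ∀ i : Fin N, W.ζ i ω ∈ I i} = ∏ i, Disconnection.expMeasure (I i) := by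
  have h1 : {ω | ∀ i : Fin N, W.ζ i ω ∈ I i}
      = eta W 0 N ⁻¹' (univ.pi fun i => (univ : Set (Zd d)) ×ˢ I i) := by
    ext ω; simp [eta]
  rw [h1, ← Measure.map_apply (measurable_eta W 0 N)
    (MeasurableSet.univ_pi fun i => MeasurableSet.univ.prod (hI i)), law_pi, Measure.pi_pi]
  refine Finset.prod_congr rfl fun i _ => ?_
  exact (Measure.prod_prod _ _).trans (by simp)

lemma good_ae (x : Zd d) : ∀ᵐ ω ∂(W.P x), Good W ω := by
  have := W.isProb x
  have h1 : ∀ᵐ ω ∂(W.P x), ∀ k, 0 < W.ζ k ω := by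
    rw [ae_all_iff]
    intro k
    have h2 := zeta_law W x (k+1) (fun i => if (i:ℕ) = k then Iic 0 else univ)
      (fun i => by split_ifs <;> simp)
    have h3 : ∏ i : Fin (k+1), Disconnection.expMeasure (if (i:ℕ) = k then Iic 0 else univ) = 0 := by
      refine Finset.prod_eq_zero (Finset.mem_univ (Fin.last k)) ?_
      simp [expM_Iic]
    rw [h3] at h2
    refine measure_mono_null ?_ h2
    intro ω hω i
    split_ifs with hi
    · have hω2 : ¬ (0 < W.ζ k ω) := hω
      rw [hi]; exact not_lt.1 hω2
    · trivial
  have h2 : ∀ᵐ ω ∂(W.P x), ∀ m, ∃ k ≥ m, 1 ≤ W.ζ k ω := by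
    rw [ae_all_iff]
    intro m
    set c := Disconnection.expMeasure (Iio 1) with hc
    have hle : ∀ N, W.P x {ω | ¬ ∃ k ≥ m, 1 ≤ W.ζ k ω} ≤ c ^ N := by
      intro N
      have h2 := zeta_law W x (m+N) (fun i => if m ≤ (i:ℕ) then Iio 1 else univ)
        (fun i => by split_ifs <;> simp)
      have h3 : ∏ i : Fin (m+N), Disconnection.expMeasure (if m ≤ (i:ℕ) then Iio 1 else univ)
          = c ^ N := by
        have h4 : ∏ i : Fin m, Disconnection.expMeasure
            (if m ≤ ((Fin.castAdd N i : Fin (m+N)) : ℕ) then Iio 1 else univ) = 1 := by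
          refine Finset.prod_eq_one fun i _ => ?_
          rw [Fin.val_castAdd, if_neg (not_le.2 i.2)]
          exact measure_univ
        rw [Fin.prod_univ_add, h4, one_mul]
        simp [hc]
      rw [← h3, ← h2]
      refine measure_mono ?_
      intro ω hω i
      split_ifs with hi
      · by_contra hcon
        exact hω ⟨i, hi, not_lt.1 hcon⟩
      · trivial
    have ht := ENNReal.tendsto_pow_atTop_nhds_zero_of_lt_one expM_Iio_lt
    exact le_antisymm (ge_of_tendsto' ht hle) zero_le
  filter_upwards [h1, h2] with ω a b using ⟨a, b⟩

variable {W} {ω : Ω}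

lemma S_zero : W.S 0 ω = 0 := by simp [SRW.S]

lemma S_succ (k : ℕ) : W.S (k+1) ω = W.S k ω + W.ζ k ω := by
  simp [SRW.S, Finset.sum_range_succ]

lemma Good.strictMono (h : Good W ω) : StrictMono fun k => W.S k ω :=
  strictMono_nat_of_lt_succ fun k => by rw [S_succ]; linarith [h.1 k]

lemma Good.unbdd (h : Good W ω) (n : ℕ) : ∃ k, (n:ℝ) ≤ W.S k ω := by
  induction n with
  | zero => exact ⟨0, by simp [S_zero]⟩
  | succ n ih =>
    obtain ⟨k, hk⟩ := ih
    obtain ⟨m, hm, hm1⟩ := h.2 k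
    refine ⟨m+1, ?_⟩
    rw [S_succ]
    have : W.S k ω ≤ W.S m ω := h.strictMono.monotone hm
    push_cast
    linarith

lemma Good.X_eq (h : Good W ω) (k : ℕ) (t : ℝ) (ht : t ∈ Ico (W.S k ω) (W.S (k+1) ω)) :
    W.X t ω = W.Y k ω := by
  have : W.jumpIdx t ω = k := by
    have : {j : ℕ | W.S j ω ≤ t} = Iic k := by
      ext j
      simp only [mem_ofPred_eq, mem_Iic]
      constructor
      · intro hj
        have h1 : W.S j ω < W.S (k+1) ω := lt_of_le_of_lt hj ht.2
        exact Nat.lt_succ_iff.1 (h.strictMono.lt_iff_lt.1 h1)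
      · intro hj
        exact (h.strictMono.monotone hj).trans ht.1
    rw [SRW.jumpIdx, this, csSup_Iic]
  rw [SRW.X, this]

lemma Good.iUnion (h : Good W ω) : ⋃ k, Ico (W.S k ω) (W.S (k+1) ω) = Ici 0 := by
  have h1 := iUnion_Ico_map_succ_eq_Ici (f := fun k : ℕ => W.S k ω)
    (fun a => h.strictMono.monotone bot_le) (by
      rintro ⟨B, hB⟩
      obtain ⟨n, hn⟩ := exists_nat_gt B
      obtain ⟨k, hk⟩ := h.unbdd n
      have := hB ⟨k, rfl⟩
      simp only at this
      linarith)
  have h2 : W.S ⊥ ω = 0 := S_zero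
  simp only [h2] at h1
  exact h1

lemma Good.exists_k (h : Good W ω) (t : ℝ) (ht : 0 ≤ t) :
    ∃ k, t ∈ Ico (W.S k ω) (W.S (k+1) ω) := by
  have : t ∈ ⋃ k, Ico (W.S k ω) (W.S (k+1) ω) := by rw [h.iUnion]; exact ht
  simpa using this

lemma Good.lint (h : Good W ω) (e : Zd d → ℝ≥0∞) :
    ∫⁻ s in Ioi (0:ℝ), e (W.X s ω) = TI W e ω := by
  rw [setLIntegral_congr Ioi_ae_eq_Ici, ← h.iUnion, lintegral_iUnion (fun _ => measurableSet_Ico)]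
  · unfold TI
    refine tsum_congr fun k => ?_
    rw [setLIntegral_congr_fun measurableSet_Ico (g := fun _ => e (W.Y k ω))]
    · rw [setLIntegral_const, Real.volume_Ico, S_succ]
      congr 2
      ring
    · intro t ht
      simp only
      rw [h.X_eq k t ht]
  · exact h.strictMono.monotone.pairwise_disjoint_on_Ico_succ

lemma Good.hitTilde (h : Good W ω) (A : Set (Zd d)) :
    W.hitTilde A ω = ⊤ ↔ ¬ ∃ k, W.Y (1 + k) ω ∈ A := by
  have hS1 : W.S 1 ω = W.ζ 0 ω := by simp [SRW.S]
  unfold SRW.hitTilde SRW.hitFrom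
  rw [sInf_eq_top]
  constructor
  · rintro h1 ⟨k, hk⟩
    have hpos : 0 ≤ W.S (1+k) ω := by
      rw [← S_zero (W := W) (ω := ω)]; exact h.strictMono.monotone (Nat.zero_le _)
    have := h1 ((Real.toNNReal (W.S (1+k) ω) : ℝ≥0) : ℝ≥0∞)
      ⟨Real.toNNReal (W.S (1+k) ω), rfl, ?_, ?_⟩
    · exact ENNReal.coe_ne_top this
    · apply ENNReal.ofReal_le_ofReal
      rw [← hS1]
      exact h.strictMono.monotone (Nat.le_add_right 1 k)
    · have : W.X (W.S (1+k) ω) ω = W.Y (1+k) ω :=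
        h.X_eq (1+k) _ ⟨le_rfl, h.strictMono (Nat.lt_succ_self _)⟩
      rw [Real.coe_toNNReal _ hpos, this]
      exact hk
  · rintro h1 u ⟨s, rfl, hs, hX⟩
    exfalso
    apply h1
    have hs' : W.ζ 0 ω ≤ s := by
      rw [← ENNReal.ofReal_coe_nnreal] at hs
      exact (ENNReal.ofReal_le_ofReal_iff s.2).1 hs
    obtain ⟨k, hk⟩ := h.exists_k s s.2
    have hk1 : 1 ≤ k := by
      by_contra hc
      have : k = 0 := by omega
      subst this
      have := hk.2
      rw [zero_add, hS1] at this
      linarith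
    refine ⟨k - 1, ?_⟩
    rw [show 1 + (k-1) = k by omega, ← h.X_eq k s hk]
    exact hX

lemma X_meas (h : Good W ω) (f : Zd d → ℝ) :
    AEStronglyMeasurable (fun s => f (W.X s ω)) (volume.restrict (Ioi (0:ℝ))) := by
  have h1 : AEStronglyMeasurable (fun s => f (W.X s ω)) (volume.restrict (⋃ k, Ico (W.S k ω) (W.S (k+1) ω))) := by
    rw [aestronglyMeasurable_iUnion_iff]
    intro k
    refine AEStronglyMeasurable.congr (f := fun _ => f (W.Y k ω)) aestronglyMeasurable_const ?_
    refine (ae_restrict_iff' measurableSet_Ico).2 (ae_of_all _ fun t ht => ?_)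
    simp only
    rw [h.X_eq k t ht]
  rw [h.iUnion] at h1
  exact h1.mono_measure (Measure.restrict_mono Ioi_subset_Ici_self le_rfl)

end Path

section Final
variable {d : ℕ} {Ω : Type*} [MeasurableSpace Ω] (W : SRW d Ω)

noncomputable def eE (A : Set (Zd d)) (x : Zd d) : ℝ≥0∞ := ENNReal.ofReal (W.eqm A x)

lemma eqm_nonneg (A : Set (Zd d)) (x : Zd d) : 0 ≤ W.eqm A x := by
  unfold SRW.eqm; split_ifs
  · exact ENNReal.toReal_nonneg
  · exact le_rfl

lemma eE_mem (A : Set (Zd d)) (x : Zd d) (hx : x ∈ A) :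
    eE W A x = 1 - Pop (stepM W) (hitI (stepM W) A) x := by
  have := W.isProb x
  unfold eE SRW.eqm
  rw [if_pos hx, ENNReal.ofReal_toReal (measure_ne_top _ _), ← prob_ret]
  have hm : MeasurableSet {ω | ∃ k, W.Y (1 + k) ω ∈ A} := by
    have : {ω | ∃ k, W.Y (1 + k) ω ∈ A} = ⋃ k, W.Y (1+k) ⁻¹' A := by
      ext ω; simp
    rw [this]
    exact MeasurableSet.iUnion fun k => W.measurable_Y _ MeasurableSet.of_discrete
  rw [← prob_compl_eq_one_sub hm]
  refine measure_congr ?_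
  filter_upwards [good_ae W x] with ω hω
  exact propext (hω.hitTilde A)

lemma eE_notMem (A : Set (Zd d)) (x : Zd d) (hx : x ∉ A) : eE W A x = 0 := by
  simp [eE, SRW.eqm, hx]

lemma eE_eq (A : Set (Zd d)) :
    eE W A + Pop (stepM W) (hitI (stepM W) A) = hitI (stepM W) A := by
  funext x
  rw [Pi.add_apply, hitI_eq _ _ x]
  split_ifs with h
  · rw [eE_mem W A x h]
    exact tsub_add_cancel_of_le (Pop_hitI_le_one _ _ _)
  · rw [eE_notMem W A x h, zero_add]

lemma cap_pos (hd : 3 ≤ d) (A : Set (Zd d)) (hfin : A.Finite) (hne : A.Nonempty) :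
    0 < W.cap A := by
  have hsupp : Function.support (W.eqm A) ⊆ hfin.toFinset := by
    intro x hx
    by_contra hc
    simp at hc
    exact hx (by simp [SRW.eqm, hc])
  unfold SRW.cap
  rw [finsum_eq_sum_of_support_subset _ hsupp]
  refine lt_of_le_of_ne (Finset.sum_nonneg fun x _ => eqm_nonneg W A x) fun h0 => ?_
  have hz : ∀ x ∈ hfin.toFinset, W.eqm A x = 0 :=
    (Finset.sum_eq_zero_iff_of_nonneg fun x _ => eqm_nonneg W A x).1 h0.symm
  have he : eE W A = fun _ => 0 := by
    funext x
    by_cases hx : x ∈ A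
    · simp [eE, hz x (hfin.mem_toFinset.2 hx)]
    · exact eE_notMem W A x hx
  obtain ⟨x, hx⟩ := hne
  have := green_eq (stepM W) A (eE W A) (eE_eq W A)
    (transience hd (stepM W) (stepM_single W) A hfin) x
  rw [he, hitI_eq, if_pos hx] at this
  simp [Pop_iter_zero] at this

lemma sum_ebar (hd : 3 ≤ d) (A : Set (Zd d)) (hfin : A.Finite) (hne : A.Nonempty) :
    ∑' x, ENNReal.ofReal (W.ebar A x) = 1 := by
  have hc := cap_pos W hd A hfin hne
  have hsupp : Function.support (W.eqm A) ⊆ hfin.toFinset := by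
    intro x hx
    by_contra hc
    simp at hc
    exact hx (by simp [SRW.eqm, hc])
  rw [tsum_eq_sum (s := hfin.toFinset)]
  · simp only [SRW.ebar]
    rw [← ENNReal.ofReal_sum_of_nonneg fun x _ => div_nonneg (eqm_nonneg W A x) hc.le]
    rw [← Finset.sum_div, ← finsum_eq_sum_of_support_subset _ hsupp]
    change ENNReal.ofReal (W.cap A / W.cap A) = 1
    rw [div_self hc.ne', ENNReal.ofReal_one]
  · intro x hx
    have : x ∉ A := fun h => hx (hfin.mem_toFinset.2 h)
    simp [SRW.ebar, SRW.eqm, this]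

end Final


/-- `E_{ē_A}[(∫₀^∞ e_A(X_s) ds)^n] = n!`. -/
theorem statement1 {d : ℕ} (hd : 3 ≤ d) {Ω : Type*} [MeasurableSpace Ω] (W : SRW d Ω)
    (A : Set (Zd d)) (hfin : A.Finite) (hne : A.Nonempty) (n : ℕ) :
    ∫ ω, (∫ s in Set.Ioi (0 : ℝ), W.eqm A (W.X s ω)) ^ n ∂ (W.Pinit (W.ebar A))
      = ((Nat.factorial n : ℕ) : ℝ) := by
  have hmom : ∀ n, ∀ x ∈ A, ∫⁻ ω, (TI W (eE W A) ω)^n ∂(W.P x) = (n.factorial : ℝ≥0∞) :=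
    fun n x hx => TI_moment W A (eE W A) (fun _ => ENNReal.ofReal_ne_top) (eE_notMem W A)
      (eE_eq W A) (transience hd (stepM W) (stepM_single W) A hfin) n x hx
  have hnA : ∀ x, x ∉ A → ENNReal.ofReal (W.ebar A x) = 0 := by
    intro x hx
    simp [SRW.ebar, SRW.eqm, hx]
  have hae : ∀ᵐ ω ∂(W.Pinit (W.ebar A)), Good W ω ∧ TI W (eE W A) ω < ⊤ := by
    unfold SRW.Pinit
    rw [Measure.ae_sum_iff]
    intro x
    by_cases hx : x ∈ A
    · refine Measure.ae_smul_measure ?_ _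
      have h1 := hmom 1 x hx
      simp only [pow_one] at h1
      have h2 := ae_lt_top (meas_TI W (eE W A)) (by rw [h1]; simp)
      filter_upwards [good_ae W x, h2] with ω a b using ⟨a, b⟩
    · rw [hnA x hx]; simp
  have hL : ∀ᵐ ω ∂(W.Pinit (W.ebar A)),
      (∫ s in Set.Ioi (0 : ℝ), W.eqm A (W.X s ω)) ^ n = (TI W (eE W A) ω ^ n).toReal := by
    filter_upwards [hae] with ω hω
    rw [integral_eq_lintegral_of_nonneg_ae (ae_of_all _ fun s => eqm_nonneg W A _)
      (X_meas hω.1 _), ENNReal.toReal_pow]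
    congr 2
    exact hω.1.lint (eE W A)
  rw [integral_congr_ae hL, integral_toReal ((meas_TI W (eE W A)).pow_const n).aemeasurable
    (hae.mono fun ω hω => ENNReal.pow_lt_top hω.2)]
  have hfinal : ∫⁻ ω, (TI W (eE W A) ω)^n ∂(W.Pinit (W.ebar A)) = (n.factorial : ℝ≥0∞) := by
    unfold SRW.Pinit
    rw [lintegral_sum_measure]
    simp only [lintegral_smul_measure, smul_eq_mul]
    have : ∀ x, ENNReal.ofReal (W.ebar A x) * ∫⁻ ω, (TI W (eE W A) ω)^n ∂(W.P x)
        = ENNReal.ofReal (W.ebar A x) * (n.factorial : ℝ≥0∞) := by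
      intro x
      by_cases hx : x ∈ A
      · rw [hmom n x hx]
      · rw [hnA x hx, zero_mul, zero_mul]
    simp only [this]
    rw [ENNReal.tsum_mul_right, sum_ebar W hd A hfin hne, one_mul]
  rw [hfinal]
  simp
end
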